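/- arXiv:2604.18442 — 4 statements merged into one kernel-verified Lean document; each statement's English description precedes it below -/
import Mathlib

section
/- For every ℓ ∈ ℕ there exists a constant C_ℓ > 0 such that for all real T ≥ 2, setting κ = ⌊√T⌋, for all integers 0 ≤ j ≤ κ−1 and all u ∈ ℤ, the oscillatory integral E_j(n) := (2π)^{−1} ∫_0^{2π} e^{i(T cos x − n x)} ω_j(e^{ix}) dx satisfies |E_j(⌈n_j⌉ + u)| ≤ C_ℓ · κ^{−1} · (1 + |u|/κ)^{−ℓ}, where n_j := −T sin(2πj/κ) and ⌈·⌉ is the ceiling function. -/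
open MeasureTheory Filter Topology

noncomputable section

/-- ω_j(e^{ix}) = ∑_{p∈ℤ} h(κ(x − 2πp) − 2πj), as a function of x ∈ ℝ. -/
def omegaFun (h : ℝ → ℝ) (κ j : ℕ) (x : ℝ) : ℝ :=
  ∑' p : ℤ, h (κ * (x - 2 * Real.pi * p) - 2 * Real.pi * j)

/-- `h` is a smooth nonnegative function supported in [−2π, 2π] with ∑_p h(y − 2πp) = 1. -/
def IsBumpPartition (h : ℝ → ℝ) : Prop :=
  ContDiff ℝ (⊤ : ℕ∞) h ∧ (∀ y, 0 ≤ h y) ∧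
    (∀ y : ℝ, y ∉ Set.Icc (-(2 * Real.pi)) (2 * Real.pi) → h y = 0) ∧
    ∀ y : ℝ, (∑' p : ℤ, h (y - 2 * Real.pi * p)) = 1

/-- The oscillatory integral `E_j(n) = (2π)⁻¹ ∫₀^{2π} e^{i(T cos x − nx)} ω_j(e^{ix}) dx`. -/
def oscInt (h : ℝ → ℝ) (κ j : ℕ) (T : ℝ) (n : ℤ) : ℂ :=
  (2 * Real.pi)⁻¹ *
    ∫ x in (0 : ℝ)..(2 * Real.pi),
      Complex.exp (Complex.I * ((T * Real.cos x : ℝ) - (n : ℝ) * x)) * (omegaFun h κ j x : ℂ)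

lemma norm_iteratedDeriv_cexp_ofReal_mul_I (n : ℕ) (t : ℝ) :
    ‖iteratedDeriv n (fun t : ℝ => Complex.exp (t * Complex.I)) t‖ = 1 := by
  have key : ∀ n : ℕ, iteratedDeriv n (fun t : ℝ => Complex.exp (t * Complex.I)) =
      fun t : ℝ => Complex.I ^ n * Complex.exp (t * Complex.I) := by
    intro n
    induction n with
    | zero => simp
    | succ n ih =>
      rw [iteratedDeriv_succ, ih]
      ext t
      have h1 : HasDerivAt (fun t : ℝ => (t : ℂ) * Complex.I) (1 * Complex.I) t :=
        (Complex.ofRealCLM.hasDerivAt (x := t)).mul_const _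
      rw [(h1.cexp.const_mul (Complex.I ^ n)).deriv]
      ring
  rw [key]
  simp [Complex.norm_exp_ofReal_mul_I]

lemma contDiff_cexp_ofReal_mul_I : ContDiff ℝ (⊤ : ℕ∞) (fun t : ℝ => Complex.exp (t * Complex.I)) :=
  (Complex.ofRealCLM.contDiff.mul contDiff_const).cexp

/-- If all derivatives of the phase `g` grow at most geometrically on `[-R, R]`, the derivatives of
`e^{ig} h` are bounded uniformly in `g`. -/
lemma exists_bound_iteratedDeriv_cexp_mul {h : ℝ → ℝ} (hs : ContDiff ℝ (⊤ : ℕ∞) h) (R D : ℝ)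
    (n : ℕ) :
    ∃ C : ℝ, ∀ g : ℝ → ℝ, ContDiff ℝ (⊤ : ℕ∞) g →
      (∀ y ∈ Set.Icc (-R) R, ∀ i, 1 ≤ i → |iteratedDeriv i g y| ≤ D ^ i) →
      ∀ y ∈ Set.Icc (-R) R,
        ‖iteratedDeriv n (fun y => Complex.exp (g y * Complex.I) * (h y : ℂ)) y‖ ≤ C := by
  have hsC : ContDiff ℝ (⊤ : ℕ∞) (fun y => (h y : ℂ)) := Complex.ofRealCLM.contDiff.comp hs
  have hb : ∀ k : ℕ, ∃ B : ℝ, ∀ y ∈ Set.Icc (-R) R,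
      ‖iteratedDeriv k (fun y => (h y : ℂ)) y‖ ≤ B := fun k =>
    isCompact_Icc.exists_bound_of_continuousOn
      (hsC.continuous_iteratedDeriv k (by exact_mod_cast le_top)).continuousOn
  choose B hB using hb
  refine ⟨∑ i ∈ Finset.range (n + 1), (n.choose i : ℝ) * (i.factorial * 1 * D ^ i) * B (n - i), ?_⟩
  intro g hg hgD y hy
  have hcomp : ContDiff ℝ (⊤ : ℕ∞) (fun y => Complex.exp (g y * Complex.I)) :=
    contDiff_cexp_ofReal_mul_I.comp hg
  rw [← norm_iteratedFDeriv_eq_norm_iteratedDeriv]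
  refine (norm_iteratedFDeriv_mul_le hcomp hsC y (n := n) (by exact_mod_cast le_top)).trans ?_
  refine Finset.sum_le_sum fun i _ => ?_
  have h1 : ‖iteratedFDeriv ℝ i (fun y => Complex.exp (g y * Complex.I)) y‖ ≤
      i.factorial * 1 * D ^ i := by
    refine norm_iteratedFDeriv_comp_le (g := fun t : ℝ => Complex.exp (t * Complex.I))
      contDiff_cexp_ofReal_mul_I hg (by exact_mod_cast le_top) y ?_ ?_
    · intro k _
      rw [norm_iteratedFDeriv_eq_norm_iteratedDeriv, norm_iteratedDeriv_cexp_ofReal_mul_I]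
    · intro k hk _
      rw [norm_iteratedFDeriv_eq_norm_iteratedDeriv]
      exact hgD y hy k hk
  have h2 := hB (n - i) y hy
  rw [← norm_iteratedFDeriv_eq_norm_iteratedDeriv] at h2
  have h0 := (norm_nonneg _).trans h1
  gcongr

/-- Uniform polynomial decay of `∫ e^{i(g(y) - sy)} h(y) dy` in `s`. -/
lemma exists_decay_bound {h : ℝ → ℝ} (hs : ContDiff ℝ (⊤ : ℕ∞) h) {R : ℝ} (hR : 0 ≤ R)
    (hsupp : ∀ y ∉ Set.Icc (-R) R, h y = 0) (D : ℝ) (n : ℕ) :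
    ∃ C : ℝ, ∀ g : ℝ → ℝ, ContDiff ℝ (⊤ : ℕ∞) g →
      (∀ y ∈ Set.Icc (-R) R, ∀ i, 1 ≤ i → |iteratedDeriv i g y| ≤ D ^ i) →
      ∀ s : ℝ, |s| ^ n *
        ‖∫ y : ℝ, Complex.exp ((g y - s * y : ℝ) * Complex.I) * (h y : ℂ)‖ ≤ C := by
  obtain ⟨C, hC⟩ := exists_bound_iteratedDeriv_cexp_mul hs R D n
  refine ⟨2 * R * C, fun g hg hgD s => ?_⟩
  set F : ℝ → ℂ := fun y => Complex.exp (g y * Complex.I) * (h y : ℂ) with hF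
  have hFs : ContDiff ℝ (⊤ : ℕ∞) F :=
    (contDiff_cexp_ofReal_mul_I.comp hg).mul (Complex.ofRealCLM.contDiff.comp hs)
  have hF0 : Function.support F ⊆ Set.Icc (-R) R := by
    intro y hy
    by_contra hy'
    exact hy (by simp [hF, hsupp y hy'])
  have htF : tsupport F ⊆ Set.Icc (-R) R := closure_minimal hF0 isClosed_Icc
  have hsuppk : ∀ k : ℕ, ∀ y ∉ Set.Icc (-R) R, iteratedDeriv k F y = 0 := by
    intro k y hy
    have : iteratedFDeriv ℝ k F y = 0 := by
      by_contra hne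
      exact hy (htF (support_iteratedFDeriv_subset k hne))
    rw [← norm_eq_zero, ← norm_iteratedFDeriv_eq_norm_iteratedDeriv, this, norm_zero]
  have hint : ∀ k : ℕ, Integrable (iteratedDeriv k F) := fun k =>
    (hFs.continuous_iteratedDeriv k (by exact_mod_cast le_top)).integrable_of_hasCompactSupport
      (HasCompactSupport.intro isCompact_Icc (hsuppk k))
  have hfour := Real.fourier_iteratedDeriv (N := ⊤) (n := n) hFs (fun k _ => hint k)
    (by exact_mod_cast le_top)
  have hval := congrFun hfour (s / (2 * Real.pi))
  have hpi := Real.pi_pos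
  have hI : FourierTransform.fourier F (s / (2 * Real.pi)) =
      ∫ y : ℝ, Complex.exp ((g y - s * y : ℝ) * Complex.I) * (h y : ℂ) := by
    rw [Real.fourier_real_eq_integral_exp_smul]
    congr 1
    ext y
    rw [hF, smul_eq_mul, ← mul_assoc, ← Complex.exp_add]
    congr 2
    have : -2 * Real.pi * y * (s / (2 * Real.pi)) = - (s * y) := by field_simp
    rw [this]
    push_cast
    ring
  have hnorm : |s| ^ n * ‖∫ y : ℝ, Complex.exp ((g y - s * y : ℝ) * Complex.I) * (h y : ℂ)‖ =
      ‖FourierTransform.fourier (iteratedDeriv n F) (s / (2 * Real.pi))‖ := by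
    rw [hval, norm_smul, norm_pow, hI]
    congr 2
    have : (2 * (Real.pi : ℂ) * Complex.I * ((s / (2 * Real.pi) : ℝ) : ℂ)) = s * Complex.I := by
      push_cast
      field_simp
    rw [this]
    simp
  rw [hnorm]
  refine (VectorFourier.norm_fourierIntegral_le_integral_norm _ _ _ _ _).trans ?_
  rw [← setIntegral_eq_integral_of_forall_compl_eq_zero (s := Set.Icc (-R) R)
    (fun y hy => by rw [hsuppk n y hy, norm_zero])]
  have := norm_setIntegral_le_of_norm_le_const (μ := volume) (s := Set.Icc (-R) R)
    (f := fun y => ‖iteratedDeriv n F y‖) (C := C) (by simp)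
    (fun y hy => by rw [norm_norm]; exact hC g hg hgD y hy)
  refine (le_abs_self _).trans (this.trans (le_of_eq ?_))
  rw [Real.volume_real_Icc_of_le (by linarith)]
  ring

lemma abs_iteratedDeriv_phase_le {T k x₀ m R : ℝ} (hT : 0 ≤ T) (hk : 1 ≤ k) (hTk : T ≤ 4 * k ^ 2)
    (hm : |m + T * Real.sin x₀| ≤ 1) (hR : 0 ≤ R) {y : ℝ} (hy : y ∈ Set.Icc (-R) R) {i : ℕ}
    (hi : 1 ≤ i) :
    |iteratedDeriv i (fun y => T * Real.cos (k⁻¹ * y + x₀) - m * (k⁻¹ * y)) y| ≤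
      (4 * R + 4) ^ i := by
  have hk0 : 0 < k := by linarith
  have hkinv : k⁻¹ ≤ 1 := inv_le_one_of_one_le₀ hk
  have hkinv0 : 0 < k⁻¹ := by positivity
  have hTk' : T * k⁻¹ ^ 2 ≤ 4 := by
    rw [inv_pow, ← div_eq_mul_inv, div_le_iff₀ (by positivity)]
    exact hTk
  have hlin : ∀ y : ℝ, HasDerivAt (fun y => k⁻¹ * y + x₀) k⁻¹ y := fun y => by
    simpa using ((hasDerivAt_id y).const_mul k⁻¹).add_const x₀
  have hd1 : deriv (fun y => T * Real.cos (k⁻¹ * y + x₀) - m * (k⁻¹ * y)) =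
      fun y => -T * k⁻¹ * Real.sin (k⁻¹ * y + x₀) - m * k⁻¹ := by
    ext y
    have := (((hlin y).cos.const_mul T).sub (((hasDerivAt_id y).const_mul k⁻¹).const_mul m)).deriv
    refine Eq.trans this ?_
    ring
  match i, hi with
  | 1, _ =>
    rw [iteratedDeriv_one, hd1, pow_one]
    have h1 : |Real.sin (k⁻¹ * y + x₀) - Real.sin x₀| ≤ k⁻¹ * R := by
      have := Real.abs_sin_sub_sin_le (k⁻¹ * y + x₀) x₀
      rw [add_sub_cancel_right, abs_mul, abs_of_pos hkinv0] at this
      exact this.trans (by gcongr; exact abs_le.2 hy)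
    have h2 : -T * k⁻¹ * Real.sin (k⁻¹ * y + x₀) - m * k⁻¹ =
        -(T * k⁻¹ * (Real.sin (k⁻¹ * y + x₀) - Real.sin x₀)) +
          -(k⁻¹ * (m + T * Real.sin x₀)) := by ring
    simp only [h2]
    refine (abs_add_le _ _).trans ?_
    rw [abs_neg, abs_neg, abs_mul, abs_mul k⁻¹, abs_of_pos hkinv0, abs_of_nonneg (by positivity)]
    have h3 : T * k⁻¹ * |Real.sin (k⁻¹ * y + x₀) - Real.sin x₀| ≤ T * k⁻¹ * (k⁻¹ * R) := by gcongr
    have h4 : T * k⁻¹ * (k⁻¹ * R) ≤ 4 * R := by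
      calc T * k⁻¹ * (k⁻¹ * R) = T * k⁻¹ ^ 2 * R := by ring
        _ ≤ _ := by gcongr
    have h5 : k⁻¹ * |m + T * Real.sin x₀| ≤ 1 := mul_le_one₀ hkinv (abs_nonneg _) hm
    linarith
  | i + 2, _ =>
    have hd2 : deriv (fun y => -T * k⁻¹ * Real.sin (k⁻¹ * y + x₀) - m * k⁻¹) =
        fun y => (-T * k⁻¹ ^ 2) * Real.cos (k⁻¹ * y + x₀) := by
      ext y
      have := (((hlin y).sin.const_mul (-T * k⁻¹)).sub_const (m * k⁻¹)).deriv
      refine Eq.trans this ?_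
      ring
    have hcos : ContDiff ℝ (i : WithTop ℕ∞) fun z => Real.cos (z + x₀) := by fun_prop
    rw [iteratedDeriv_succ', iteratedDeriv_succ', hd1, hd2, iteratedDeriv_const_mul _
      (by fun_prop), iteratedDeriv_comp_const_mul (f := fun z => Real.cos (z + x₀)) hcos,
      iteratedDeriv_comp_add_const, abs_mul, abs_mul, abs_mul, abs_neg, abs_of_nonneg hT,
      abs_of_pos (by positivity : (0 : ℝ) < k⁻¹ ^ 2), abs_of_pos (by positivity : 0 < k⁻¹ ^ i)]
    have h1 := Real.abs_iteratedDeriv_cos_le_one i (k⁻¹ * y + x₀)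
    have h2 : k⁻¹ ^ i ≤ 1 := pow_le_one₀ hkinv0.le hkinv
    calc T * k⁻¹ ^ 2 * (k⁻¹ ^ i * |iteratedDeriv i Real.cos (k⁻¹ * y + x₀)|)
        ≤ 4 * (1 * 1) := by gcongr
      _ ≤ 4 * R + 4 := by linarith
      _ ≤ (4 * R + 4) ^ (i + 2) := le_self_pow₀ (by linarith) (by omega)

/-- Unfolding of a periodized compactly supported function. -/
lemma intervalIntegral_mul_tsum_eq_integral {e : ℝ → ℂ} {f : ℝ → ℝ} (he : Continuous e)
    (hf : Continuous f) (hfc : HasCompactSupport f) {L : ℝ} (hL : 0 < L)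
    (hper : Function.Periodic e L) :
    ∫ x in (0 : ℝ)..L, e x * ((∑' p : ℤ, f (x - L * p) : ℝ) : ℂ) = ∫ x : ℝ, e x * (f x : ℂ) := by
  obtain ⟨r, hr⟩ := hfc.isCompact.isBounded.subset_closedBall 0
  have hzero : ∀ x, r < |x| → f x = 0 := by
    intro x hx
    by_contra hne
    have := hr (subset_tsupport f hne)
    rw [mem_closedBall_zero_iff, Real.norm_eq_abs] at this
    linarith
  obtain ⟨N, hN⟩ := exists_nat_gt ((r + L) / L)
  have hN' : r + L < N * L := by rwa [div_lt_iff₀ hL] at hN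
  set S : Finset ℤ := Finset.Icc (-(N : ℤ)) N with hS
  have hout : ∀ p : ℤ, p ∉ S → ∀ x ∈ Set.Icc 0 L, f (x - L * p) = 0 := by
    intro p hp x hx
    apply hzero
    have hp' : (N : ℝ) < |(p : ℝ)| := by
      have : (N : ℤ) < |p| := by
        by_contra hle
        exact hp (Finset.mem_Icc.2 (abs_le.1 (not_lt.1 hle)))
      exact_mod_cast this
    have h1 : |L * (p : ℝ)| ≤ |x - L * p| + |x| := by
      have := abs_sub_abs_le_abs_sub (L * (p : ℝ)) x
      rw [abs_sub_comm] at this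
      linarith
    rw [abs_mul, abs_of_pos hL, abs_of_nonneg hx.1] at h1
    nlinarith [hx.2]
  have hperp : ∀ (p : ℤ) (x : ℝ), e (x - L * p) = e x := fun p x => by
    rw [mul_comm]; exact hper.sub_int_mul_eq p
  set Φ : ℝ → ℂ := fun x => e x * (f x : ℂ) with hΦ
  have hΦc : Continuous Φ := by fun_prop
  have hΦi : Integrable Φ := hΦc.integrable_of_hasCompactSupport
    ((hfc.comp_left (g := fun y : ℝ => (y : ℂ)) Complex.ofReal_zero).mul_left)
  have hleft : ∫ x in (0 : ℝ)..L, e x * ((∑' p : ℤ, f (x - L * p) : ℝ) : ℂ) =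
      ∑ p ∈ S, ∫ x in (0 : ℝ)..L, Φ (x - L * p) := by
    rw [← intervalIntegral.integral_finsetSum]
    · refine intervalIntegral.integral_congr fun x hx => ?_
      rw [Set.uIcc_of_le hL.le] at hx
      rw [tsum_eq_sum (s := S) (fun p hp => hout p hp x hx), Complex.ofReal_sum, Finset.mul_sum]
      simp only [hΦ, hperp]
    · intro p _
      exact (by fun_prop : Continuous fun x => Φ (x - L * p)).intervalIntegrable _ _
  have hsum : HasSum (fun p : ℤ => ∫ t in (0 : ℝ)..1, Φ (L * (t + p))) (∫ t, Φ (L * t)) :=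
    (hΦi.comp_mul_left' hL.ne').hasSum_intervalIntegral_comp_add_int
  have hterm : ∀ p : ℤ, ∫ x in (0 : ℝ)..L, Φ (x - L * p) =
      L * ∫ t in (0 : ℝ)..1, Φ (L * (t + (-p : ℤ))) := by
    intro p
    have h1 := intervalIntegral.smul_integral_comp_mul_left (fun x => Φ (x - L * p)) L
      (a := 0) (b := 1)
    rw [mul_zero, mul_one, Complex.real_smul] at h1
    rw [← h1]
    congr 2
    ext t
    congr 1
    push_cast
    ring
  have hsum' := ((Equiv.neg ℤ).hasSum_iff.2 hsum).mul_left (L : ℂ)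
  have hfin : HasSum (fun p : ℤ => ∫ x in (0 : ℝ)..L, Φ (x - L * p))
      (∑ p ∈ S, ∫ x in (0 : ℝ)..L, Φ (x - L * p)) := by
    refine hasSum_sum_of_ne_finset_zero fun p hp => ?_
    rw [intervalIntegral.integral_congr (g := fun _ => 0), intervalIntegral.integral_zero]
    intro x hx
    rw [Set.uIcc_of_le hL.le] at hx
    simp [hΦ, hout p hp x hx]
  rw [hleft]
  refine hfin.unique ?_
  simp only [hterm]
  have hscale : (L : ℂ) * ∫ t, Φ (L * t) = ∫ t, Φ t := by
    rw [Measure.integral_comp_mul_left, abs_of_pos (inv_pos.2 hL), Complex.real_smul, ← mul_assoc,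
      ← Complex.ofReal_mul, mul_inv_cancel₀ hL.ne', Complex.ofReal_one, one_mul]
  rw [hscale] at hsum'
  exact hsum'

lemma oscInt_eq_integral {h : ℝ → ℝ} (hs : Continuous h) {R : ℝ}
    (hsupp : ∀ y ∉ Set.Icc (-R) R, h y = 0) {κ : ℕ} (hκ : 0 < κ) (j : ℕ) (T : ℝ) (n : ℤ) :
    oscInt h κ j T n = (2 * Real.pi)⁻¹ * ((κ : ℝ)⁻¹ * ∫ y : ℝ,
      Complex.exp (Complex.I * ((T * Real.cos ((κ : ℝ)⁻¹ * y + 2 * Real.pi * j / κ) : ℝ) -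
        (n : ℝ) * ((κ : ℝ)⁻¹ * y + 2 * Real.pi * j / κ : ℝ))) * (h y : ℂ)) := by
  have hκ' : (0 : ℝ) < κ := by exact_mod_cast hκ
  have hpi := Real.pi_pos
  set e : ℝ → ℂ := fun x => Complex.exp (Complex.I * ((T * Real.cos x : ℝ) - (n : ℝ) * x)) with he
  set f : ℝ → ℝ := fun x => h (κ * x - 2 * Real.pi * j) with hf
  have hper : Function.Periodic e (2 * Real.pi) := by
    intro x
    simp only [he]
    rw [Real.cos_add_two_pi]
    rw [Complex.exp_eq_exp_iff_exists_int]
    refine ⟨-n, ?_⟩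
    push_cast
    ring
  have hfc : HasCompactSupport f := by
    refine HasCompactSupport.intro (K := Set.Icc ((κ : ℝ)⁻¹ * (-R + 2 * Real.pi * j))
      ((κ : ℝ)⁻¹ * (R + 2 * Real.pi * j))) isCompact_Icc fun x hx => hsupp _ fun hx' => hx ?_
    rw [Set.mem_Icc, inv_mul_le_iff₀ hκ', le_inv_mul_iff₀ hκ']
    exact ⟨by linarith [hx'.1], by linarith [hx'.2]⟩
  unfold oscInt
  congr 1
  refine (intervalIntegral_mul_tsum_eq_integral (e := e) (f := f) (by fun_prop) (by fun_prop) hfc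
    (by positivity) hper).trans ?_
  set G : ℝ → ℂ := fun y => e ((κ : ℝ)⁻¹ * y + 2 * Real.pi * j / κ) * (h y : ℂ) with hG
  have h1 : (fun x => e x * (f x : ℂ)) = fun x => G (κ * x - 2 * Real.pi * j) := by
    ext x
    simp only [hG, hf]
    congr 2
    field_simp
    ring
  rw [h1, Measure.integral_comp_mul_left (fun z => G (z - 2 * Real.pi * j)),
    integral_sub_right_eq_self G, abs_of_pos (inv_pos.2 hκ'), Complex.real_smul]

/-- Nonstationary-phase bound for the free evolution of a bump: with `κ = ⌊√T⌋` and
`n_j = −T sin(2πj/κ)`, one has `|E_j(⌈n_j⌉ + u)| ≤ C_ℓ κ⁻¹ (1 + |u|/κ)^{−ℓ}`. -/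
theorem bump_evolution_bound (h : ℝ → ℝ) (hh : IsBumpPartition h) (ℓ : ℕ) :
    ∃ C : ℝ, 0 < C ∧ ∀ T : ℝ, 2 ≤ T →
      ∀ j : ℕ, j < Nat.floor (Real.sqrt T) → ∀ u : ℤ,
        ‖oscInt h (Nat.floor (Real.sqrt T)) j T
            (Int.ceil (-(T * Real.sin (2 * Real.pi * j / Nat.floor (Real.sqrt T)))) + u)‖ ≤
          C * ((Nat.floor (Real.sqrt T) : ℝ))⁻¹ *
            ((1 + |(u : ℝ)| / (Nat.floor (Real.sqrt T) : ℝ)) ^ ℓ)⁻¹ := by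
  obtain ⟨hs, -, hsupp, -⟩ := hh
  have hpi := Real.pi_pos
  have hpi3 := Real.pi_gt_three
  have hR : 0 ≤ 2 * Real.pi := by positivity
  obtain ⟨A, hA⟩ := exists_decay_bound hs hR hsupp (4 * (2 * Real.pi) + 4) 0
  obtain ⟨B, hB⟩ := exists_decay_bound hs hR hsupp (4 * (2 * Real.pi) + 4) ℓ
  refine ⟨2 ^ ℓ * (|A| + |B|) + 1, by positivity, fun T hT j hj u => ?_⟩
  set κ := Nat.floor (Real.sqrt T) with hκ
  have hκpos : 0 < κ := by omega
  have hκ1 : (1 : ℝ) ≤ κ := by exact_mod_cast hκpos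
  have hTκ : T ≤ 4 * (κ : ℝ) ^ 2 := by
    have h1 : Real.sqrt T < κ + 1 := Nat.lt_floor_add_one _
    have h2 : Real.sqrt T ^ 2 = T := Real.sq_sqrt (by linarith)
    have h3 : Real.sqrt T ≤ 2 * κ := by linarith
    have h4 := pow_le_pow_left₀ (Real.sqrt_nonneg T) h3 2
    linarith [h4, mul_pow 2 (κ : ℝ) 2]
  set x₀ : ℝ := 2 * Real.pi * j / κ with hx₀
  set m : ℤ := Int.ceil (-(T * Real.sin x₀)) with hm
  have hm1 : |(m : ℝ) + T * Real.sin x₀| ≤ 1 := by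
    have h1 := Int.le_ceil (-(T * Real.sin x₀))
    have h2 := Int.ceil_lt_add_one (-(T * Real.sin x₀))
    rw [abs_le]
    constructor <;> linarith
  set g : ℝ → ℝ := fun y => T * Real.cos ((κ : ℝ)⁻¹ * y + x₀) - m * ((κ : ℝ)⁻¹ * y) with hg
  have hgs : ContDiff ℝ (⊤ : ℕ∞) g := by fun_prop
  have hgD : ∀ y ∈ Set.Icc (-(2 * Real.pi)) (2 * Real.pi), ∀ i, 1 ≤ i →
      |iteratedDeriv i g y| ≤ (4 * (2 * Real.pi) + 4) ^ i := fun y hy i hi =>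
    abs_iteratedDeriv_phase_le (by linarith) hκ1 hTκ hm1 hR hy hi
  set s : ℝ := u / κ with hs'
  set J : ℂ := ∫ y : ℝ, Complex.exp ((g y - s * y : ℝ) * Complex.I) * (h y : ℂ) with hJ
  have hA' : ‖J‖ ≤ |A| := by
    have := hA g hgs hgD s
    rw [pow_zero, one_mul] at this
    exact this.trans (le_abs_self _)
  have hB' : |s| ^ ℓ * ‖J‖ ≤ |B| := (hB g hgs hgD s).trans (le_abs_self _)
  have hnorm : ‖oscInt h κ j T (m + u)‖ = (2 * Real.pi)⁻¹ * ((κ : ℝ)⁻¹ * ‖J‖) := by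
    rw [oscInt_eq_integral hs.continuous hsupp hκpos]
    have hfac : ∀ y : ℝ, Complex.exp (Complex.I * ((T * Real.cos ((κ : ℝ)⁻¹ * y + x₀) : ℝ) -
        ((m + u : ℤ) : ℝ) * ((κ : ℝ)⁻¹ * y + x₀ : ℝ))) * (h y : ℂ) =
        Complex.exp ((-((m + u) * x₀) : ℝ) * Complex.I) *
          (Complex.exp ((g y - s * y : ℝ) * Complex.I) * (h y : ℂ)) := by
      intro y
      rw [← mul_assoc, ← Complex.exp_add]
      congr 2
      simp only [hg, hs']
      push_cast
      ring
    simp only [← hx₀, hfac]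
    rw [integral_const_mul, norm_mul, norm_mul, norm_mul, Complex.norm_exp_ofReal_mul_I, one_mul]
    congr 1
    · rw [Complex.norm_real, Real.norm_of_nonneg (by positivity)]
    · rw [Complex.norm_real, Real.norm_of_nonneg (by positivity)]
  have hsabs : |(u : ℝ)| / κ = |s| := by rw [hs', abs_div, Nat.abs_cast]
  have hJ1 : (1 + |s|) ^ ℓ * ‖J‖ ≤ 2 ^ ℓ * (|A| + |B|) + 1 := by
    have h1 : (1 + |s|) ^ ℓ ≤ 2 ^ ℓ * (1 + |s| ^ ℓ) := by
      rcases le_total |s| 1 with hle | hle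
      · calc (1 + |s|) ^ ℓ ≤ (2 : ℝ) ^ ℓ := by gcongr; linarith
          _ ≤ _ := le_mul_of_one_le_right (by positivity) (by linarith [pow_nonneg (abs_nonneg s) ℓ])
      · calc (1 + |s|) ^ ℓ ≤ (2 * |s|) ^ ℓ := by gcongr; linarith
          _ = 2 ^ ℓ * |s| ^ ℓ := mul_pow _ _ _
          _ ≤ _ := by gcongr; linarith
    calc (1 + |s|) ^ ℓ * ‖J‖ ≤ 2 ^ ℓ * (1 + |s| ^ ℓ) * ‖J‖ := by gcongr
      _ = 2 ^ ℓ * (‖J‖ + |s| ^ ℓ * ‖J‖) := by ring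
      _ ≤ 2 ^ ℓ * (|A| + |B|) := by gcongr
      _ ≤ _ := by linarith
  have h2pi : (2 * Real.pi)⁻¹ ≤ 1 := inv_le_one_of_one_le₀ (by linarith)
  rw [hnorm, hsabs]
  have hpos : 0 < (1 + |s|) ^ ℓ := by positivity
  have hJ2 : ‖J‖ ≤ (2 ^ ℓ * (|A| + |B|) + 1) * ((1 + |s|) ^ ℓ)⁻¹ := by
    rw [← div_eq_mul_inv, le_div_iff₀ hpos, mul_comm]
    exact hJ1
  calc (2 * Real.pi)⁻¹ * ((κ : ℝ)⁻¹ * ‖J‖) ≤ 1 * ((κ : ℝ)⁻¹ * ‖J‖) := by gcongr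
    _ ≤ (κ : ℝ)⁻¹ * ((2 ^ ℓ * (|A| + |B|) + 1) * ((1 + |s|) ^ ℓ)⁻¹) := by rw [one_mul]; gcongr
    _ = _ := by ring

end
end

section
/- Assume ∑_{n≥0} |γ_n|² ≤ 1/4. For each ℓ ∈ ℕ with ℓ ≥ 2 there exists a constant C_ℓ > 0 such that: for every real ν ≥ 1, every arc I = {e^{ix} : |x − x₀| ≤ 1/(2ν)} (x₀ ∈ ℝ) of angular length 1/ν, and every integer m ≥ ν, one has ∫_I |φ_m(z)|² dσ(z) ≤ C_ℓ ( ν^{−1} + ∑_{n=0}^∞ (n+1)^{−ℓ} ∑_{s∈ℕ, |s−m|<ν(n+1)} |γ_s|² + (m/ν)^{−ℓ} ). -/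
open MeasureTheory Filter Topology Polynomial

noncomputable section

/-- The pair (Φ_n, Φ_n*) of monic orthogonal and reversed polynomials, defined from the
Verblunsky coefficients `γ` via the Szegő recurrence. -/
def szPair (γ : ℕ → ℂ) : ℕ → Polynomial ℂ × Polynomial ℂ
  | 0 => (1, 1)
  | n + 1 =>
      (Polynomial.X * (szPair γ n).1 - Polynomial.C (starRingEnd ℂ (γ n)) * (szPair γ n).2,
       (szPair γ n).2 - Polynomial.X * Polynomial.C (γ n) * (szPair γ n).1)

/-- The monic orthogonal polynomial Φ_n. -/
def szPhi (γ : ℕ → ℂ) (n : ℕ) : Polynomial ℂ := (szPair γ n).1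

/-- The reversed polynomial Φ_n*. -/
def szPhiStar (γ : ℕ → ℂ) (n : ℕ) : Polynomial ℂ := (szPair γ n).2

/-- The L²(σ) norm ‖f‖_{2,σ} of a function f. -/
def l2norm (σ : Measure ℂ) (f : ℂ → ℂ) : ℝ := Real.sqrt (∫ z, ‖f z‖ ^ 2 ∂σ)

/-- The orthonormal polynomial φ_n = Φ_n / ‖Φ_n‖_{2,σ}, as a function on ℂ. -/
def phiN (γ : ℕ → ℂ) (σ : Measure ℂ) (n : ℕ) (z : ℂ) : ℂ :=
  (szPhi γ n).eval z / (l2norm σ fun w => (szPhi γ n).eval w)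

/-- The reversed orthonormal polynomial φ_n* = Φ_n* / ‖Φ_n‖_{2,σ}, as a function on ℂ. -/
def phiStarN (γ : ℕ → ℂ) (σ : Measure ℂ) (n : ℕ) (z : ℂ) : ℂ :=
  (szPhiStar γ n).eval z / (l2norm σ fun w => (szPhi γ n).eval w)

/-- s_n(z) = z^{−n} φ_{2n}(z). -/
def sN (γ : ℕ → ℂ) (σ : Measure ℂ) (n : ℕ) (z : ℂ) : ℂ :=
  z ^ (-(n : ℤ)) * phiN γ σ (2 * n) z

/-- `γ` is the Verblunsky sequence of `σ`: the polynomials Φ_n produced from `γ` by the Szegő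
recurrence are the monic orthogonal polynomials of `σ`, i.e. Φ_n ⟂ z^k in L²(σ) for k < n. -/
def IsVerblunsky (γ : ℕ → ℂ) (σ : Measure ℂ) : Prop :=
  ∀ n k : ℕ, k < n → ∫ z, (szPhi γ n).eval z * (starRingEnd ℂ z) ^ k ∂σ = 0

/-- `σ` lives on the unit circle 𝕋. -/
def OnCircle (σ : Measure ℂ) : Prop := ∀ᵐ z ∂σ, ‖z‖ = 1

/-- The support of `σ` is an infinite set: `σ` is not carried by any finite set. -/
def InfiniteSupport (σ : Measure ℂ) : Prop := ∀ s : Finset ℂ, σ ((↑s : Set ℂ)ᶜ) ≠ 0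

/-- Normalized arclength (Haar) measure on the unit circle, as a measure on ℂ. -/
def mCircle : Measure ℂ :=
  Measure.map (fun x : ℝ => Complex.exp (x * Complex.I))
    ((ENNReal.ofReal (2 * Real.pi))⁻¹ • volume.restrict (Set.Ioc 0 (2 * Real.pi)))

/-- The bump ω_j as a function on the circle (via the argument of z). -/
def omegaT (h : ℝ → ℝ) (κ j : ℕ) (z : ℂ) : ℝ := omegaFun h κ j z.arg

/-- The Cauchy transform at `ζ` of `Φ_n conj(Φ_m) dσ`. -/
def cauchyPhi (γ : ℕ → ℂ) (σ : Measure ℂ) (m : ℕ) (ζ : ℂ) (n : ℕ) : ℂ :=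
  ∫ w, (szPhi γ n).eval w * starRingEnd ℂ ((szPhi γ m).eval w) / (w - ζ) ∂σ

/-- The Cauchy transform at `ζ` of `Φ_n* conj(Φ_m) dσ`. -/
def cauchyPhiStar (γ : ℕ → ℂ) (σ : Measure ℂ) (m : ℕ) (ζ : ℂ) (n : ℕ) : ℂ :=
  ∫ w, (szPhiStar γ n).eval w * starRingEnd ℂ ((szPhi γ m).eval w) / (w - ζ) ∂σ

/-- The Gram matrix entry `⟨Φ_n, Φ_m⟩` in `L²(σ)`. -/
def gramPhi (γ : ℕ → ℂ) (σ : Measure ℂ) (m n : ℕ) : ℂ :=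
  ∫ w, (szPhi γ n).eval w * starRingEnd ℂ ((szPhi γ m).eval w) ∂σ

section Polynomials

variable (γ : ℕ → ℂ)

theorem eval_szPhi_succ (n : ℕ) (z : ℂ) : (szPhi γ (n + 1)).eval z =
    z * (szPhi γ n).eval z - starRingEnd ℂ (γ n) * (szPhiStar γ n).eval z := by
  simp only [szPhi, szPhiStar, szPair, eval_sub, eval_mul, eval_X, eval_C]

theorem eval_szPhiStar_succ (n : ℕ) (z : ℂ) : (szPhiStar γ (n + 1)).eval z =
    (szPhiStar γ n).eval z - z * γ n * (szPhi γ n).eval z := by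
  simp only [szPhi, szPhiStar, szPair, eval_sub, eval_mul, eval_X, eval_C]

theorem natDegree_szPair_le (n : ℕ) :
    (szPhi γ n).natDegree ≤ n ∧ (szPhiStar γ n).natDegree ≤ n := by
  induction n with
  | zero => simp [szPhi, szPhiStar, szPair]
  | succ n ih =>
    obtain ⟨h₁, h₂⟩ := ih
    have hX : (X * szPhi γ n).natDegree ≤ n + 1 :=
      natDegree_mul_le.trans (by rw [natDegree_X]; omega)
    have e₁ : szPhi γ (n + 1) = X * szPhi γ n - C (starRingEnd ℂ (γ n)) * szPhiStar γ n := rfl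
    have e₂ : szPhiStar γ (n + 1) = szPhiStar γ n - C (γ n) * (X * szPhi γ n) := by
      simp only [szPhiStar, szPhi, szPair]; ring
    rw [e₁, e₂]
    exact ⟨natDegree_sub_le_of_le hX ((natDegree_C_mul_le _ _).trans (by omega)) |>.trans (by simp),
      natDegree_sub_le_of_le (h₂.trans n.le_succ) ((natDegree_C_mul_le _ _).trans hX)
        |>.trans (by simp)⟩

theorem eval_szPhiStar_eq (n : ℕ) {z : ℂ} (hz : ‖z‖ = 1) :
    (szPhiStar γ n).eval z = z ^ n * starRingEnd ℂ ((szPhi γ n).eval z) := by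
  have hzz : z * starRingEnd ℂ z = 1 := by
    rw [Complex.mul_conj, Complex.normSq_eq_norm_sq, hz]; simp
  induction n with
  | zero => simp [szPhi, szPhiStar, szPair]
  | succ n ih =>
    rw [eval_szPhiStar_succ, eval_szPhi_succ, ih]
    have hn : z ^ n * starRingEnd ℂ z ^ n = 1 := by rw [← mul_pow, hzz, one_pow]
    simp only [map_sub, map_mul, map_pow, Complex.conj_conj]
    linear_combination (-(z ^ n * starRingEnd ℂ ((szPhi γ n).eval z))) * hzz +
      z * γ n * (szPhi γ n).eval z * hn

end Polynomials

section Integrals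

variable {σ : Measure ℂ} {γ : ℕ → ℂ}

theorem OnCircle.integrable [IsFiniteMeasure σ] (hcirc : OnCircle σ)
    {E : Type*} [NormedAddCommGroup E] {f : ℂ → E}
    (hf : ContinuousOn f (Metric.sphere 0 1)) : Integrable f σ := by
  have h : σ.restrict (Metric.sphere 0 1) = σ :=
    Measure.restrict_eq_self_of_ae_mem (hcirc.mono fun z hz => by simpa using hz)
  rw [← h]
  exact hf.integrableOn_compact (isCompact_sphere 0 1)

theorem integral_szPhi_mul_conj_eval [IsFiniteMeasure σ] (hcirc : OnCircle σ)
    (hV : IsVerblunsky γ σ) {n : ℕ} {p : ℂ[X]} (hp : p.natDegree < n) :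
    ∫ z, (szPhi γ n).eval z * starRingEnd ℂ (p.eval z) ∂σ = 0 := by
  have h (z : ℂ) : (szPhi γ n).eval z * starRingEnd ℂ (p.eval z) =
      ∑ i ∈ Finset.range n, starRingEnd ℂ (p.coeff i) *
        ((szPhi γ n).eval z * starRingEnd ℂ z ^ i) := by
    rw [eval_eq_sum_range' hp, map_sum, Finset.mul_sum]
    refine Finset.sum_congr rfl fun i _ => ?_
    simp only [map_mul, map_pow]; ring
  simp_rw [h]
  rw [integral_finsetSum]
  · refine Finset.sum_eq_zero fun i hi => ?_
    rw [integral_const_mul, hV n i (Finset.mem_range.1 hi), mul_zero]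
  · intro i _
    exact hcirc.integrable (by fun_prop)

theorem gramPhi_eq_zero_of_lt [IsFiniteMeasure σ] (hcirc : OnCircle σ) (hV : IsVerblunsky γ σ)
    {m n : ℕ} (h : m < n) : gramPhi γ σ m n = 0 :=
  integral_szPhi_mul_conj_eval hcirc hV ((natDegree_szPair_le γ m).1.trans_lt h)

theorem gramPhi_eq_zero [IsFiniteMeasure σ] (hcirc : OnCircle σ) (hV : IsVerblunsky γ σ)
    {m n : ℕ} (h : m ≠ n) : gramPhi γ σ m n = 0 := by
  rcases h.lt_or_gt with h | h
  · exact gramPhi_eq_zero_of_lt hcirc hV h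
  · have h' : gramPhi γ σ m n = starRingEnd ℂ (gramPhi γ σ n m) := by
      rw [gramPhi, gramPhi, ← integral_conj]
      congr 1; ext w
      simp only [map_mul, Complex.conj_conj]; ring
    rw [h', gramPhi_eq_zero_of_lt hcirc hV h, map_zero]

theorem gramPhi_self (m : ℕ) :
    gramPhi γ σ m m = ((∫ w, ‖(szPhi γ m).eval w‖ ^ 2 ∂σ : ℝ) : ℂ) := by
  rw [gramPhi, ← integral_complex_ofReal]
  congr 1; ext w
  rw [Complex.mul_conj, Complex.normSq_eq_norm_sq]

theorem integral_norm_szPhi_sq_le_one [IsProbabilityMeasure σ] (hcirc : OnCircle σ)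
    (hV : IsVerblunsky γ σ) (n : ℕ) : ∫ w, ‖(szPhi γ n).eval w‖ ^ 2 ∂σ ≤ 1 := by
  induction n with
  | zero => simp [szPhi, szPair]
  | succ n ih =>
    have hInt (k : ℕ) : Integrable (fun w => ‖(szPhi γ k).eval w‖ ^ 2) σ :=
      hcirc.integrable (by fun_prop)
    have hdeg : (C (starRingEnd ℂ (γ n)) * szPhiStar γ n).natDegree < n + 1 :=
      ((natDegree_C_mul_le _ _).trans (natDegree_szPair_le γ n).2).trans_lt n.lt_succ_self
    have h₀ := integral_szPhi_mul_conj_eval hcirc hV hdeg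
    have h₁ : gramPhi γ σ (n + 1) (n + 1) =
        ∫ w, (szPhi γ (n + 1)).eval w * starRingEnd ℂ (w * (szPhi γ n).eval w) ∂σ := by
      rw [← sub_zero (∫ w, _ ∂σ), ← h₀, ← integral_sub, gramPhi]
      · congr 1; ext w
        rw [← mul_sub, ← map_sub, eval_mul, eval_C, ← eval_szPhi_succ]
      · exact hcirc.integrable (by fun_prop)
      · exact hcirc.integrable (by fun_prop)
    rw [gramPhi_self] at h₁
    have h₂ : ∫ w, ‖(szPhi γ (n + 1)).eval w‖ ^ 2 ∂σ ≤
        ∫ w, (‖(szPhi γ (n + 1)).eval w‖ ^ 2 / 2 + ‖(szPhi γ n).eval w‖ ^ 2 / 2) ∂σ := by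
      refine (le_abs_self _).trans ?_
      rw [← Real.norm_eq_abs, ← Complex.norm_real, h₁]
      refine norm_integral_le_of_norm_le (((hInt _).div_const 2).add ((hInt _).div_const 2)) ?_
      filter_upwards [hcirc] with w hw
      rw [norm_mul, RCLike.norm_conj, norm_mul, hw, one_mul]
      nlinarith [sq_nonneg (‖(szPhi γ (n + 1)).eval w‖ - ‖(szPhi γ n).eval w‖)]
    rw [integral_add ((hInt _).div_const 2) ((hInt _).div_const 2), integral_div,
      integral_div] at h₂
    linarith

theorem sub_ne_zero_of_norm_lt_one {ζ w : ℂ} (hζ : ‖ζ‖ < 1) (hw : ‖w‖ = 1) : w - ζ ≠ 0 := by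
  intro h
  rw [sub_eq_zero] at h
  rw [h] at hw
  linarith

variable [IsFiniteMeasure σ]

theorem OnCircle.integrable_eval_div (hcirc : OnCircle σ) {ζ : ℂ} (hζ : ‖ζ‖ < 1) (p q : ℂ[X]) :
    Integrable (fun w => p.eval w * starRingEnd ℂ (q.eval w) / (w - ζ)) σ := by
  refine hcirc.integrable (ContinuousOn.div (by fun_prop) (by fun_prop) fun w hw => ?_)
  exact sub_ne_zero_of_norm_lt_one hζ (by simpa using hw)

theorem OnCircle.integrable_eval (hcirc : OnCircle σ) (p q : ℂ[X]) :
    Integrable (fun w => p.eval w * starRingEnd ℂ (q.eval w)) σ :=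
  hcirc.integrable (by fun_prop)

theorem integral_mul_eval_div (hcirc : OnCircle σ) {ζ : ℂ} (hζ : ‖ζ‖ < 1) (m n : ℕ) :
    ∫ w, (X * szPhi γ n).eval w * starRingEnd ℂ ((szPhi γ m).eval w) / (w - ζ) ∂σ =
      ζ * cauchyPhi γ σ m ζ n + gramPhi γ σ m n := by
  rw [cauchyPhi, gramPhi, ← integral_const_mul,
    ← integral_add ((hcirc.integrable_eval_div hζ _ _).const_mul _) (hcirc.integrable_eval _ _)]
  refine integral_congr_ae (hcirc.mono fun w hw => ?_)
  have := sub_ne_zero_of_norm_lt_one hζ hw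
  simp only [eval_mul, eval_X]
  field_simp
  ring

theorem cauchyPhi_succ (hcirc : OnCircle σ) {ζ : ℂ} (hζ : ‖ζ‖ < 1) (m n : ℕ) :
    cauchyPhi γ σ m ζ (n + 1) = (ζ * cauchyPhi γ σ m ζ n + gramPhi γ σ m n) -
      starRingEnd ℂ (γ n) * cauchyPhiStar γ σ m ζ n := by
  rw [← integral_mul_eval_div hcirc hζ, cauchyPhiStar, ← integral_const_mul,
    ← integral_sub (hcirc.integrable_eval_div hζ _ _)
      ((hcirc.integrable_eval_div hζ _ _).const_mul _), cauchyPhi]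
  congr 1; ext w
  simp only [eval_szPhi_succ, eval_mul, eval_X]
  ring

theorem cauchyPhiStar_succ (hcirc : OnCircle σ) {ζ : ℂ} (hζ : ‖ζ‖ < 1) (m n : ℕ) :
    cauchyPhiStar γ σ m ζ (n + 1) = cauchyPhiStar γ σ m ζ n -
      γ n * (ζ * cauchyPhi γ σ m ζ n + gramPhi γ σ m n) := by
  rw [← integral_mul_eval_div hcirc hζ, cauchyPhiStar, ← integral_const_mul, cauchyPhiStar,
    ← integral_sub (hcirc.integrable_eval_div hζ _ _)
      ((hcirc.integrable_eval_div hζ _ _).const_mul _)]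
  congr 1; ext w
  simp only [eval_szPhiStar_succ, eval_mul, eval_X]
  ring


theorem norm_cauchyPhiStar_le {σ : Measure ℂ} [IsProbabilityMeasure σ] (hcirc : OnCircle σ)
    (hV : IsVerblunsky γ σ) {ζ : ℂ} (hζ : ‖ζ‖ < 1) {m n : ℕ} (hmn : m < n) :
    ‖cauchyPhiStar γ σ m ζ n‖ ≤ ‖ζ‖ ^ (n - m) / (1 - ‖ζ‖) := by
  obtain ⟨k, rfl⟩ := Nat.exists_eq_add_of_lt hmn
  set S : ℂ[X] := ∑ i ∈ Finset.range (k + 1), X ^ i * C ζ ^ (k + 1 - 1 - i) with hS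
  have hSmul (w : ℂ) : S.eval w * (w - ζ) = w ^ (k + 1) - ζ ^ (k + 1) := by
    rw [← geom_sum₂_mul w ζ, hS, eval_finsetSum]
    simp
  have hSdeg : S.natDegree ≤ k := by
    refine natDegree_sum_le_of_forall_le _ _ fun i hi => ?_
    rw [← C_pow]
    exact (natDegree_mul_C_le _ _).trans
      ((natDegree_X_pow_le i).trans (Nat.lt_succ_iff.1 (Finset.mem_range.1 hi)))
  have hdeg : (S * szPhiStar γ m).natDegree < m + k + 1 := by
    have := (natDegree_mul_le (p := S) (q := szPhiStar γ m)).trans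
      (add_le_add hSdeg (natDegree_szPair_le γ m).2)
    omega
  have h₀ : ∫ w, (S * szPhiStar γ m).eval w *
      starRingEnd ℂ ((szPhi γ (m + k + 1)).eval w) ∂σ = 0 := by
    rw [← map_zero (starRingEnd ℂ), ← integral_szPhi_mul_conj_eval hcirc hV hdeg, ← integral_conj]
    congr 1; ext w
    simp only [map_mul, Complex.conj_conj]; ring
  have h₁ : cauchyPhiStar γ σ m ζ (m + k + 1) = ∫ w, ζ ^ (k + 1) * ((szPhiStar γ m).eval w *
      starRingEnd ℂ ((szPhi γ (m + k + 1)).eval w) / (w - ζ)) ∂σ := by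
    rw [← zero_add (∫ w, _ ∂σ), ← h₀, ← integral_add (hcirc.integrable_eval _ _)
      ((hcirc.integrable_eval_div hζ _ _).const_mul _), cauchyPhiStar]
    refine integral_congr_ae (hcirc.mono fun w hw => ?_)
    have hne := sub_ne_zero_of_norm_lt_one hζ hw
    simp only [eval_mul]
    rw [eval_szPhiStar_eq γ _ hw, eval_szPhiStar_eq γ _ hw]
    field_simp
    linear_combination (-(starRingEnd ℂ ((szPhi γ (m + k + 1)).eval w) * w ^ m *
      starRingEnd ℂ ((szPhi γ m).eval w))) * hSmul w
  have hInt (k : ℕ) : Integrable (fun w => ‖(szPhi γ k).eval w‖ ^ 2 / 2) σ :=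
    hcirc.integrable (by fun_prop)
  have hr : 0 < 1 - ‖ζ‖ := sub_pos.2 hζ
  have h₂ : ‖cauchyPhiStar γ σ m ζ (m + k + 1)‖ ≤ ∫ w, ‖ζ‖ ^ (k + 1) / (1 - ‖ζ‖) *
      (‖(szPhi γ (m + k + 1)).eval w‖ ^ 2 / 2 + ‖(szPhi γ m).eval w‖ ^ 2 / 2) ∂σ := by
    rw [h₁]
    refine norm_integral_le_of_norm_le (((hInt _).add (hInt _)).const_mul _) ?_
    filter_upwards [hcirc] with w hw
    have hle : 1 - ‖ζ‖ ≤ ‖w - ζ‖ := hw ▸ norm_sub_norm_le w ζ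
    rw [eval_szPhiStar_eq γ _ hw]
    simp only [norm_mul, norm_div, norm_pow, RCLike.norm_conj, hw, one_pow, one_mul]
    rw [← mul_div_assoc, div_mul_eq_mul_div]
    gcongr
    nlinarith [sq_nonneg (‖(szPhi γ (m + k + 1)).eval w‖ - ‖(szPhi γ m).eval w‖)]
  refine h₂.trans ?_
  rw [integral_const_mul, integral_add (hInt _) (hInt _), integral_div, integral_div,
    show m + k + 1 - m = k + 1 by omega]
  refine mul_le_of_le_one_right (by positivity) ?_
  linarith [integral_norm_szPhi_sq_le_one hcirc hV m,
    integral_norm_szPhi_sq_le_one hcirc hV (m + k + 1)]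

theorem tendsto_cauchyPhiStar {σ : Measure ℂ} [IsProbabilityMeasure σ] (hcirc : OnCircle σ)
    (hV : IsVerblunsky γ σ) {ζ : ℂ} (hζ : ‖ζ‖ < 1) (m : ℕ) :
    Tendsto (cauchyPhiStar γ σ m ζ) atTop (𝓝 0) := by
  have h := ((tendsto_pow_atTop_nhds_zero_of_lt_one (norm_nonneg ζ) hζ).comp
    (tendsto_sub_atTop_nat m)).div_const (1 - ‖ζ‖)
  rw [zero_div] at h
  refine squeeze_zero_norm' ?_ h
  filter_upwards [eventually_gt_atTop m] with n hn
  exact norm_cauchyPhiStar_le hcirc hV hζ hn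

end Integrals

section Recurrence

theorem norm_sub_conj_mul_sq_sub (γ Q S : ℂ) :
    ‖Q - starRingEnd ℂ γ * S‖ ^ 2 - ‖S - γ * Q‖ ^ 2 = (1 - ‖γ‖ ^ 2) * (‖Q‖ ^ 2 - ‖S‖ ^ 2) := by
  simp only [← Complex.normSq_eq_norm_sq, Complex.normSq_apply, Complex.sub_re, Complex.sub_im,
    Complex.mul_re, Complex.mul_im, Complex.conj_re, Complex.conj_im]
  ring

theorem one_sub_sum_range_le_prod (f : ℕ → ℝ) (h₀ : ∀ n, 0 ≤ f n) (h₁ : ∀ n, f n ≤ 1) (k : ℕ) :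
    1 - ∑ i ∈ Finset.range k, f i ≤ ∏ i ∈ Finset.range k, (1 - f i) := by
  induction k with
  | zero => simp
  | succ k ih =>
    rw [Finset.sum_range_succ, Finset.prod_range_succ]
    have hp : ∏ i ∈ Finset.range k, (1 - f i) ≤ 1 :=
      Finset.prod_le_one (fun i _ => sub_nonneg.2 (h₁ i)) fun i _ => by linarith [h₀ i]
    nlinarith [h₀ k]

variable {γ P Q S : ℕ → ℂ} {ζ : ℂ}

/-- The decaying solution of the Szegő recurrence satisfies `|S| ≤ |Q|`. -/
theorem norm_le_of_tendsto_zero (hζ : ‖ζ‖ ≤ 1)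
    (hsum : Summable fun n => ‖γ n‖ ^ 2) (hsum4 : (∑' n, ‖γ n‖ ^ 2) ≤ 1 / 4)
    (hP : ∀ n, P (n + 1) = Q n - starRingEnd ℂ (γ n) * S n)
    (hS : ∀ n, S (n + 1) = S n - γ n * Q n)
    (hQ : ∀ n, Q (n + 1) = ζ * P (n + 1))
    (hlim : Tendsto S atTop (𝓝 0)) (n : ℕ) : ‖S n‖ ≤ ‖Q n‖ := by
  by_contra! hlt
  have hpos : 0 < ‖S n‖ ^ 2 - ‖Q n‖ ^ 2 := by nlinarith [norm_nonneg (Q n)]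
  have hle1 (i : ℕ) : ‖γ i‖ ^ 2 ≤ 1 :=
    (hsum.le_tsum i fun _ _ => by positivity).trans (hsum4.trans (by norm_num))
  have hgrow (j : ℕ) : (∏ i ∈ Finset.range j, (1 - ‖γ (n + i)‖ ^ 2)) *
      (‖S n‖ ^ 2 - ‖Q n‖ ^ 2) ≤ ‖S (n + j)‖ ^ 2 - ‖Q (n + j)‖ ^ 2 := by
    induction j with
    | zero => simp
    | succ j ih =>
      have hid := norm_sub_conj_mul_sq_sub (γ (n + j)) (Q (n + j)) (S (n + j))
      rw [← hP, ← hS] at hid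
      have hQn : ‖Q (n + j + 1)‖ ^ 2 ≤ ‖P (n + j + 1)‖ ^ 2 := by
        rw [hQ, norm_mul]
        gcongr
        exact mul_le_of_le_one_left (norm_nonneg _) hζ
      rw [Finset.prod_range_succ, ← add_assoc]
      nlinarith [mul_le_mul_of_nonneg_left ih (sub_nonneg.2 (hle1 (n + j)))]
  have hlow (j : ℕ) : 3 / 4 * (‖S n‖ ^ 2 - ‖Q n‖ ^ 2) ≤ ‖S (j + n)‖ ^ 2 := by
    have hs : ∑ i ∈ Finset.range j, ‖γ (n + i)‖ ^ 2 ≤ 1 / 4 := by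
      have := hsum.sum_le_tsum ((Finset.range j).map (addLeftEmbedding n))
        fun _ _ => by positivity
      simp only [Finset.sum_map, addLeftEmbedding_apply] at this
      exact this.trans hsum4
    have hp := one_sub_sum_range_le_prod (fun i => ‖γ (n + i)‖ ^ 2) (fun _ => by positivity)
      (fun i => hle1 _) j
    rw [add_comm j n]
    nlinarith [hgrow j, sq_nonneg ‖Q (n + j)‖]
  have hlim' : Tendsto (fun j => ‖S (j + n)‖ ^ 2) atTop (𝓝 0) := by
    have := ((tendsto_add_atTop_iff_nat n).2 hlim).norm.pow 2
    simpa using this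
  have := ge_of_tendsto' hlim' hlow
  linarith

/-- One backward step of the Schur algorithm, with `‖S / Q‖ ≤ 1 - u`. -/
theorem le_norm_sub_norm_of_step {g P' Q' S' q s : ℂ} {u : ℝ} (hu : 0 ≤ u) (hζ : ‖ζ‖ ≤ 1)
    (hg : ‖g‖ < 1) (hP : P' = q - starRingEnd ℂ g * s) (hS : S' = s - g * q) (hQ : Q' = ζ * P')
    (h : u * ‖Q'‖ ≤ ‖Q'‖ - ‖S'‖) :
    (1 - ‖g‖) ^ 2 * (1 - ‖ζ‖ + ‖ζ‖ * u) * ‖q‖ ≤ ‖q‖ - ‖s‖ := by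
  have hgg : g * starRingEnd ℂ g = ((‖g‖ ^ 2 : ℝ) : ℂ) := by
    rw [Complex.mul_conj, Complex.normSq_eq_norm_sq]
  have hpos : 0 < 1 - ‖g‖ ^ 2 := by nlinarith [norm_nonneg g]
  have hX : ‖P' + starRingEnd ℂ g * S'‖ = (1 - ‖g‖ ^ 2) * ‖q‖ := by
    rw [← abs_of_pos hpos, ← Real.norm_eq_abs, ← Complex.norm_real, ← norm_mul]
    congr 1
    rw [Complex.ofReal_sub, ← hgg, hP, hS, Complex.ofReal_one]; ring
  have hY : ‖S' + g * P'‖ = (1 - ‖g‖ ^ 2) * ‖s‖ := by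
    rw [← abs_of_pos hpos, ← Real.norm_eq_abs, ← Complex.norm_real, ← norm_mul]
    congr 1
    rw [Complex.ofReal_sub, ← hgg, hP, hS, Complex.ofReal_one]; ring
  have hid := norm_sub_conj_mul_sq_sub (-g) P' S'
  simp only [map_neg, neg_mul, sub_neg_eq_add, norm_neg] at hid
  have hXle : ‖P' + starRingEnd ℂ g * S'‖ ≤ ‖P'‖ + ‖g‖ * ‖S'‖ :=
    (norm_add_le _ _).trans (by rw [norm_mul, RCLike.norm_conj])
  have hYle : ‖S' + g * P'‖ ≤ ‖S'‖ + ‖g‖ * ‖P'‖ :=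
    (norm_add_le _ _).trans (by rw [norm_mul])
  rw [hQ, norm_mul] at h
  refine le_of_mul_le_mul_left ?_ hpos
  rw [mul_sub, ← hX, ← hY, mul_left_comm, ← hX]
  clear hX hY hP hS hQ hgg
  set x := ‖P' + starRingEnd ℂ g * S'‖
  set y := ‖S' + g * P'‖
  have hx : 0 ≤ x := norm_nonneg _
  have hy : 0 ≤ y := norm_nonneg _
  have ha := norm_nonneg S'
  have hb := norm_nonneg P'
  have hg0 := norm_nonneg g
  have hr0 := norm_nonneg ζ
  generalize ‖S'‖ = a at *
  generalize ‖P'‖ = b at *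
  generalize ‖g‖ = G at *
  generalize ‖ζ‖ = r at *
  have ht : (1 - r + r * u) * b ≤ b - a := by nlinarith
  have ht0 : 0 ≤ 1 - r + r * u := by nlinarith [mul_nonneg hr0 hu]
  have hab : 0 ≤ b - a := (mul_nonneg ht0 hb).trans ht
  have hxb : x ≤ (1 + G) * b := by nlinarith
  have hdiff : (1 - G) * (b - a) ≤ x - y := by
    rcases (add_nonneg hx hy).eq_or_lt with h0 | h0
    · have hx0 : x = 0 := by linarith
      have hy0 : y = 0 := by linarith
      rw [hx0, hy0] at hid
      have : (b - a) * (b + a) = 0 := by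
        have : (1 - G ^ 2) * ((b - a) * (b + a)) = 0 := by linarith
        exact (mul_eq_zero.1 this).resolve_left hpos.ne'
      have hba : b - a = 0 := by
        rcases mul_eq_zero.1 this with h | h <;> linarith
      rw [hba, hx0, hy0]; simp
    · refine le_of_mul_le_mul_right ?_ h0
      have h1 : x + y ≤ (1 + G) * (a + b) := by linarith
      have := mul_le_mul_of_nonneg_left h1 (mul_nonneg (sub_nonneg.2 hg.le) hab)
      linarith
  calc (1 - G) ^ 2 * (1 - r + r * u) * x
      ≤ (1 - G) ^ 2 * (1 - r + r * u) * ((1 + G) * b) := by gcongr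
    _ = (1 - G ^ 2) * ((1 - G) * ((1 - r + r * u) * b)) := by ring
    _ ≤ 1 * ((1 - G) * (b - a)) := by
        have : 0 ≤ 1 - G := sub_nonneg.2 hg.le
        gcongr
        nlinarith
    _ ≤ x - y := by linarith

theorem lower_bound_norm_sub_norm (hζ : ‖ζ‖ ≤ 1) (hγ : ∀ n, ‖γ n‖ < 1)
    (hP : ∀ n, P (n + 1) = Q n - starRingEnd ℂ (γ n) * S n)
    (hS : ∀ n, S (n + 1) = S n - γ n * Q n)
    (hQ : ∀ n, Q (n + 1) = ζ * P (n + 1))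
    (hSQ : ∀ n, ‖S n‖ ≤ ‖Q n‖) (k n : ℕ) :
    (1 - ‖ζ‖) * k * ‖ζ‖ ^ k * (∏ j ∈ Finset.range k, (1 - ‖γ (n + j)‖)) ^ 2 * ‖Q n‖ ≤
      ‖Q n‖ - ‖S n‖ := by
  induction k generalizing n with
  | zero => simpa using hSQ n
  | succ k ih =>
    have hr : 0 ≤ 1 - ‖ζ‖ := sub_nonneg.2 hζ
    refine le_trans ?_ (le_norm_sub_norm_of_step (by positivity) hζ (hγ n) (hP n) (hS n) (hQ n)
      (ih (n + 1)))
    refine mul_le_mul_of_nonneg_right ?_ (norm_nonneg _)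
    have hshift : ∏ j ∈ Finset.range k, (1 - ‖γ (n + (j + 1))‖) =
        ∏ j ∈ Finset.range k, (1 - ‖γ (n + 1 + j)‖) :=
      Finset.prod_congr rfl fun j _ => by rw [add_assoc, add_comm 1 j]
    rw [Finset.prod_range_succ', hshift, add_zero, mul_pow]
    set p := ∏ j ∈ Finset.range k, (1 - ‖γ (n + 1 + j)‖)
    have hp0 : 0 ≤ p := Finset.prod_nonneg fun j _ => sub_nonneg.2 (hγ _).le
    have hp1 : p ≤ 1 := Finset.prod_le_one (fun j _ => sub_nonneg.2 (hγ _).le)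
      fun j _ => by linarith [norm_nonneg (γ (n + 1 + j))]
    have hle : ‖ζ‖ ^ (k + 1) * p ^ 2 ≤ 1 :=
      mul_le_one₀ (pow_le_one₀ (norm_nonneg _) hζ) (by positivity) (pow_le_one₀ hp0 hp1)
    have h2 := mul_le_mul_of_nonneg_left hle hr
    have h3 : (1 - ‖ζ‖) * (k + 1) * ‖ζ‖ ^ (k + 1) * p ^ 2 ≤
        1 - ‖ζ‖ + ‖ζ‖ * ((1 - ‖ζ‖) * k * ‖ζ‖ ^ k * p ^ 2) := by
      rw [pow_succ] at h2 ⊢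
      nlinarith
    push_cast
    have h4 := mul_le_mul_of_nonneg_left h3 (sq_nonneg (1 - ‖γ n‖))
    linarith

end Recurrence

section ArcEstimate

variable {σ : Measure ℂ} {γ : ℕ → ℂ}

theorem norm_cauchyPhi_le_norm_cauchyPhiStar [IsFiniteMeasure σ] (hcirc : OnCircle σ)
    (hV : IsVerblunsky γ σ) {ζ : ℂ} (hζ : ‖ζ‖ < 1) (hγ : ∀ n, ‖γ n‖ ≤ 1) {m n : ℕ}
    (hn : n ≤ m) : ‖cauchyPhi γ σ m ζ n‖ ≤ ‖cauchyPhiStar γ σ m ζ n‖ := by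
  induction n with
  | zero => simp [cauchyPhi, cauchyPhiStar, szPhi, szPhiStar, szPair]
  | succ n ih =>
    have hid := norm_sub_conj_mul_sq_sub (γ n) (ζ * cauchyPhi γ σ m ζ n + gramPhi γ σ m n)
      (cauchyPhiStar γ σ m ζ n)
    rw [← cauchyPhi_succ hcirc hζ, ← cauchyPhiStar_succ hcirc hζ,
      gramPhi_eq_zero hcirc hV (by omega), add_zero, norm_mul] at hid
    have h₁ : ‖ζ‖ * ‖cauchyPhi γ σ m ζ n‖ ≤ ‖cauchyPhiStar γ σ m ζ n‖ :=
      (mul_le_of_le_one_left (norm_nonneg _) hζ.le).trans (ih (by omega))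
    have h₂ : (‖ζ‖ * ‖cauchyPhi γ σ m ζ n‖) ^ 2 ≤ ‖cauchyPhiStar γ σ m ζ n‖ ^ 2 := by gcongr
    have h₃ : ‖γ n‖ ^ 2 ≤ 1 := pow_le_one₀ (norm_nonneg _) (hγ n)
    refine le_of_sq_le_sq ?_ (norm_nonneg _)
    nlinarith

theorem integral_poisson_mul_norm_szPhi_sq [IsFiniteMeasure σ] (hcirc : OnCircle σ)
    {ζ : ℂ} (hζ : ‖ζ‖ < 1) (m : ℕ) :
    ∫ w, (1 - ‖ζ‖ ^ 2) / ‖w - ζ‖ ^ 2 * ‖(szPhi γ m).eval w‖ ^ 2 ∂σ =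
      ∫ w, ‖(szPhi γ m).eval w‖ ^ 2 ∂σ + 2 * (ζ * cauchyPhi γ σ m ζ m).re := by
  have hInt := (hcirc.integrable_eval_div hζ (szPhi γ m) (szPhi γ m)).const_mul ζ
  have h₁ : (ζ * cauchyPhi γ σ m ζ m).re = ∫ w, (ζ * ((szPhi γ m).eval w *
      starRingEnd ℂ ((szPhi γ m).eval w) / (w - ζ))).re ∂σ := by
    rw [cauchyPhi, ← integral_const_mul]
    exact (integral_re hInt).symm
  have hInt' : Integrable (fun w => (ζ * ((szPhi γ m).eval w *
      starRingEnd ℂ ((szPhi γ m).eval w) / (w - ζ))).re) σ := hInt.re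
  rw [h₁, ← integral_const_mul, ← integral_add (hcirc.integrable (by fun_prop))
    (hInt'.const_mul 2)]
  refine integral_congr_ae (hcirc.mono fun w hw => ?_)
  have hne := sub_ne_zero_of_norm_lt_one hζ hw
  have hre : (1 - ‖ζ‖ ^ 2) / ‖w - ζ‖ ^ 2 = 1 + 2 * (ζ / (w - ζ)).re := by
    have hw' : w.re * w.re + w.im * w.im = 1 := by
      rw [← Complex.normSq_apply, Complex.normSq_eq_norm_sq, hw, one_pow]
    have hpos : Complex.normSq (w - ζ) ≠ 0 := by simpa using hne
    rw [Complex.div_re, ← Complex.normSq_eq_norm_sq, ← Complex.normSq_eq_norm_sq]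
    field_simp
    simp only [Complex.normSq_apply, Complex.sub_re, Complex.sub_im]
    linear_combination -hw'
  have hmul : ζ * ((szPhi γ m).eval w * starRingEnd ℂ ((szPhi γ m).eval w) / (w - ζ)) =
      ζ / (w - ζ) * ((‖(szPhi γ m).eval w‖ ^ 2 : ℝ) : ℂ) := by
    rw [Complex.mul_conj, Complex.normSq_eq_norm_sq]; ring
  simp only [hmul, Complex.re_mul_ofReal, hre]
  ring

theorem norm_exp_sub_mul_exp_le {r x x₀ : ℝ} (hr : r ≤ 1) :
    ‖Complex.exp (x * Complex.I) - r * Complex.exp (x₀ * Complex.I)‖ ≤ |x - x₀| + (1 - r) := by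
  have h : Complex.exp (x * Complex.I) - r * Complex.exp (x₀ * Complex.I) =
      Complex.exp (x₀ * Complex.I) * (Complex.exp (Complex.I * (x - x₀ : ℝ)) - 1) +
        (1 - r : ℝ) * Complex.exp (x₀ * Complex.I) := by
    rw [mul_sub, ← Complex.exp_add]
    push_cast
    ring_nf
  rw [h]
  refine (norm_add_le _ _).trans ?_
  rw [norm_mul, norm_mul, Complex.norm_exp_ofReal_mul_I, one_mul, mul_one, Complex.norm_real,
    Real.norm_of_nonneg (sub_nonneg.2 hr)]
  gcongr
  exact Real.norm_exp_I_mul_ofReal_sub_one_le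

theorem setIntegral_arc_norm_szPhi_sq_le [IsFiniteMeasure σ] (hcirc : OnCircle σ)
    {ν : ℝ} (hν : 1 ≤ ν) (x₀ : ℝ) (m : ℕ) {ζ : ℂ}
    (hζ : ζ = (1 - 1 / (2 * ν) : ℝ) * Complex.exp (x₀ * Complex.I)) :
    ∫ z in (fun x : ℝ => Complex.exp (x * Complex.I)) ''
        Set.Icc (x₀ - 1 / (2 * ν)) (x₀ + 1 / (2 * ν)), ‖(szPhi γ m).eval z‖ ^ 2 ∂σ ≤
      2 / ν * (∫ w, ‖(szPhi γ m).eval w‖ ^ 2 ∂σ + 2 * (ζ * cauchyPhi γ σ m ζ m).re) := by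
  have hν0 : 0 < ν := one_pos.trans_le hν
  have hδ : 1 / (2 * ν) ≤ 1 / 2 := by
    rw [div_le_div_iff₀ (by positivity) (by norm_num)]; linarith
  have hδ0 : 0 < 1 / (2 * ν) := by positivity
  have hnorm : ‖ζ‖ = 1 - 1 / (2 * ν) := by
    rw [hζ, norm_mul, Complex.norm_exp_ofReal_mul_I, mul_one, Complex.norm_real,
      Real.norm_of_nonneg (by linarith)]
  have hζ1 : ‖ζ‖ < 1 := by linarith
  have hpoisson : Integrable
      (fun w => 2 / ν * ((1 - ‖ζ‖ ^ 2) / ‖w - ζ‖ ^ 2 * ‖(szPhi γ m).eval w‖ ^ 2)) σ := by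
    refine hcirc.integrable (ContinuousOn.mul (by fun_prop) (ContinuousOn.mul
      (ContinuousOn.div (by fun_prop) (by fun_prop) fun w hw => ?_) (by fun_prop)))
    exact pow_ne_zero 2
      (norm_ne_zero_iff.2 (sub_ne_zero_of_norm_lt_one hζ1 (by simpa using hw)))
  have hnn : 0 ≤ 1 - ‖ζ‖ ^ 2 := by nlinarith [norm_nonneg ζ]
  have hmeas : MeasurableSet ((fun x : ℝ => Complex.exp (x * Complex.I)) ''
      Set.Icc (x₀ - 1 / (2 * ν)) (x₀ + 1 / (2 * ν))) :=
    (isCompact_Icc.image (by fun_prop)).measurableSet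
  rw [← integral_poisson_mul_norm_szPhi_sq hcirc hζ1, ← integral_const_mul]
  refine (setIntegral_mono_on (hcirc.integrable (by fun_prop)).integrableOn
    hpoisson.integrableOn hmeas ?_).trans (setIntegral_le_integral hpoisson
      (Eventually.of_forall fun w => by positivity))
  rintro _ ⟨x, hx, rfl⟩
  rw [← mul_assoc]
  refine le_mul_of_one_le_left (by positivity) ?_
  have hdist : ‖Complex.exp (x * Complex.I) - ζ‖ ≤ 1 / ν := by
    rw [hζ]
    refine (norm_exp_sub_mul_exp_le (by linarith)).trans ?_
    have : |x - x₀| ≤ 1 / (2 * ν) := abs_le.2 ⟨by linarith [hx.1], by linarith [hx.2]⟩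
    have h2 : 1 / ν = 1 / (2 * ν) + 1 / (2 * ν) := by field_simp; norm_num
    linarith
  have hpos : 0 < ‖Complex.exp (x * Complex.I) - ζ‖ :=
    norm_pos_iff.2 (sub_ne_zero_of_norm_lt_one hζ1 (Complex.norm_exp_ofReal_mul_I x))
  have hsq : ‖Complex.exp (x * Complex.I) - ζ‖ ^ 2 ≤ (1 / ν) ^ 2 := by gcongr
  rw [← mul_div_assoc, le_div_iff₀ (by positivity), one_mul]
  refine hsq.trans ?_
  have h3 : 1 / (2 * ν) ≤ 1 - ‖ζ‖ ^ 2 := by nlinarith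
  calc (1 / ν) ^ 2 = 2 / ν * (1 / (2 * ν)) := by field_simp
    _ ≤ 2 / ν * (1 - ‖ζ‖ ^ 2) := by gcongr

theorem mul_add_two_mul_re_le {c u s : ℝ} {x : ℂ} (hc : 0 < c) (hu : 0 ≤ u) (hx : ‖x‖ ≤ s)
    (h : u * ‖x + c‖ ≤ ‖x + c‖ - s) : u * (c + 2 * x.re) ≤ 2 * c := by
  have hid : ‖x + c‖ ^ 2 - ‖x‖ ^ 2 = c * (c + 2 * x.re) := by
    simp only [← Complex.normSq_eq_norm_sq, Complex.normSq_apply, Complex.add_re, Complex.add_im,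
      Complex.ofReal_re, Complex.ofReal_im]
    ring
  have htri : ‖x + c‖ - ‖x‖ ≤ c := by
    have := norm_add_le x (c : ℂ)
    rw [Complex.norm_real, Real.norm_of_nonneg hc.le] at this
    linarith
  have hq := norm_nonneg (x + c)
  have hx0 := norm_nonneg x
  generalize ‖x + c‖ = q at *
  generalize ‖x‖ = y at *
  have h0 : u * q ≤ q - y := h.trans (by linarith)
  have h1 : 0 ≤ q - y := (mul_nonneg hu hq).trans h0
  refine le_of_mul_le_mul_left ?_ hc
  calc c * (u * (c + 2 * x.re)) = (q - y) * (u * (q + y)) := by linear_combination -u * hid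
    _ ≤ c * (2 * c) := by
      refine mul_le_mul htri ?_ (mul_nonneg hu (by linarith)) hc.le
      nlinarith

/-- The arc estimate in terms of a length `k ≤ ν` on which `∑ |γ_{m+j}| ≤ 1/2`. -/
theorem setIntegral_arc_norm_phiN_sq_le [IsProbabilityMeasure σ] (hcirc : OnCircle σ)
    (hV : IsVerblunsky γ σ)
    (hsum : Summable fun n => ‖γ n‖ ^ 2) (hsum4 : (∑' n, ‖γ n‖ ^ 2) ≤ 1 / 4)
    {ν : ℝ} (hν : 1 ≤ ν) (x₀ : ℝ) (m : ℕ) {k : ℕ} (hk : 1 ≤ k) (hkν : (k : ℝ) ≤ ν)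
    (hkγ : ∑ j ∈ Finset.range k, ‖γ (m + j)‖ ≤ 1 / 2) :
    ∫ z in (fun x : ℝ => Complex.exp (x * Complex.I)) ''
        Set.Icc (x₀ - 1 / (2 * ν)) (x₀ + 1 / (2 * ν)), ‖phiN γ σ m z‖ ^ 2 ∂σ ≤ 64 / k := by
  have hν0 : 0 < ν := one_pos.trans_le hν
  have hk0 : (0 : ℝ) < k := by exact_mod_cast hk
  set c : ℝ := ∫ w, ‖(szPhi γ m).eval w‖ ^ 2 ∂σ with hcdef
  have hc0 : 0 ≤ c := integral_nonneg fun w => by positivity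
  have hphi (z : ℂ) : ‖phiN γ σ m z‖ ^ 2 = c⁻¹ * ‖(szPhi γ m).eval z‖ ^ 2 := by
    rw [phiN, norm_div, div_pow, Complex.norm_real, Real.norm_eq_abs, sq_abs, l2norm,
      Real.sq_sqrt hc0, div_eq_inv_mul]
  simp_rw [hphi]
  rw [integral_const_mul]
  rcases hc0.eq_or_lt with hc | hc
  · rw [← hc, inv_zero, zero_mul]; positivity
  set ζ : ℂ := (1 - 1 / (2 * ν) : ℝ) * Complex.exp (x₀ * Complex.I) with hζ
  have hδ : 1 / (2 * ν) ≤ 1 / 2 := by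
    rw [div_le_div_iff₀ (by positivity) (by norm_num)]; linarith
  have hδ0 : 0 < 1 / (2 * ν) := by positivity
  have hnorm : ‖ζ‖ = 1 - 1 / (2 * ν) := by
    rw [hζ, norm_mul, Complex.norm_exp_ofReal_mul_I, mul_one, Complex.norm_real,
      Real.norm_of_nonneg (by linarith)]
  have hζ1 : ‖ζ‖ < 1 := by linarith
  have hγ (n : ℕ) : ‖γ n‖ < 1 := by
    have : ‖γ n‖ ^ 2 ≤ 1 / 4 := (hsum.le_tsum n fun _ _ => by positivity).trans hsum4
    nlinarith [norm_nonneg (γ n)]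
  set P : ℕ → ℂ := fun n => cauchyPhi γ σ m ζ (m + n)
  set S : ℕ → ℂ := fun n => cauchyPhiStar γ σ m ζ (m + n)
  set Q : ℕ → ℂ := fun n => ζ * cauchyPhi γ σ m ζ (m + n) + gramPhi γ σ m (m + n) with hQdef
  have hP (n : ℕ) : P (n + 1) = Q n - starRingEnd ℂ (γ (m + n)) * S n :=
    cauchyPhi_succ hcirc hζ1 m (m + n)
  have hS (n : ℕ) : S (n + 1) = S n - γ (m + n) * Q n :=
    cauchyPhiStar_succ hcirc hζ1 m (m + n)
  have hQ (n : ℕ) : Q (n + 1) = ζ * P (n + 1) := by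
    simp only [hQdef]
    rw [gramPhi_eq_zero hcirc hV (by omega), add_zero]
  have hlim : Tendsto S atTop (𝓝 0) := by
    have := (tendsto_add_atTop_iff_nat m).2 (tendsto_cauchyPhiStar hcirc hV hζ1 m)
    simpa only [add_comm] using this
  have hsum' : Summable fun n => ‖γ (m + n)‖ ^ 2 :=
    hsum.comp_injective (add_right_injective m)
  have hsum4' : ∑' n, ‖γ (m + n)‖ ^ 2 ≤ 1 / 4 :=
    (tsum_comp_le_tsum_of_inj hsum (fun _ => by positivity) (add_right_injective m)).trans hsum4
  have hSQ := norm_le_of_tendsto_zero hζ1.le hsum' hsum4' hP hS hQ hlim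
  have hlow := lower_bound_norm_sub_norm hζ1.le (fun n => hγ (m + n)) hP hS hQ hSQ k 0
  simp only [zero_add] at hlow
  set p := ∏ j ∈ Finset.range k, (1 - ‖γ (m + j)‖)
  have hp : 1 / 2 ≤ p := by
    have := one_sub_sum_range_le_prod (fun j => ‖γ (m + j)‖) (fun _ => norm_nonneg _)
      (fun j => (hγ _).le) k
    linarith
  have hpow : 1 / 2 ≤ ‖ζ‖ ^ k := by
    have := one_add_mul_le_pow (a := -(1 / (2 * ν))) (by linarith) k
    rw [← sub_eq_add_neg, ← hnorm] at this
    have h2 : (k : ℝ) * (1 / (2 * ν)) ≤ 1 / 2 := by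
      rw [mul_one_div, div_le_div_iff₀ (by positivity) (by norm_num)]; linarith
    linarith
  have hQ0 : Q 0 = ζ * cauchyPhi γ σ m ζ m + c := by
    simp only [hQdef, add_zero, gramPhi_self, hcdef]
  rw [hQ0] at hlow
  have hxS : ‖ζ * cauchyPhi γ σ m ζ m‖ ≤ ‖S 0‖ := by
    rw [norm_mul]
    exact (mul_le_of_le_one_left (norm_nonneg _) hζ1.le).trans
      (norm_cauchyPhi_le_norm_cauchyPhiStar hcirc hV hζ1 (fun n => (hγ n).le) le_rfl)
  set u := (1 - ‖ζ‖) * k * ‖ζ‖ ^ k * p ^ 2 with hu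
  have hule : k / (16 * ν) ≤ u := by
    calc k / (16 * ν) = (1 / (2 * ν)) * k * (1 / 2) * (1 / 2) ^ 2 := by field_simp; norm_num
      _ ≤ u := by
        rw [hu, hnorm, sub_sub_cancel, ← hnorm]
        gcongr
  have hupos : 0 < u := lt_of_lt_of_le (by positivity) hule
  have hre := mul_add_two_mul_re_le hc hupos.le hxS hlow
  have harc := setIntegral_arc_norm_szPhi_sq_le (γ := γ) hcirc hν x₀ m hζ
  have hre' : c + 2 * (ζ * cauchyPhi γ σ m ζ m).re ≤ 2 * c / u := by
    rw [le_div_iff₀ hupos]; linarith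
  calc c⁻¹ * ∫ z in (fun x : ℝ => Complex.exp (x * Complex.I)) ''
        Set.Icc (x₀ - 1 / (2 * ν)) (x₀ + 1 / (2 * ν)), ‖(szPhi γ m).eval z‖ ^ 2 ∂σ
      ≤ c⁻¹ * (2 / ν * (2 * c / u)) := by
        gcongr
        exact harc.trans (by gcongr)
    _ = 4 / ν / u := by field_simp; norm_num
    _ ≤ 4 / ν / (k / (16 * ν)) := by gcongr
    _ = 64 / k := by field_simp; norm_num

theorem exists_nat_scale {ν ε : ℝ} (hν : 1 ≤ ν) (hε : ε ≤ 1 / 4) :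
    ∃ k : ℕ, 1 ≤ k ∧ (k : ℝ) ≤ ν ∧ k * ε ≤ 1 / 4 ∧ 1 / (k : ℝ) ≤ 2 * max ν⁻¹ (4 * ε) := by
  have hν0 : 0 < ν := one_pos.trans_le hν
  set M := max ν⁻¹ (4 * ε) with hM
  have hM0 : 0 < M := lt_max_of_lt_left (inv_pos.2 hν0)
  have hM1 : M ≤ 1 := max_le (inv_le_one_of_one_le₀ hν) (by linarith)
  have hk1 : 1 ≤ ⌊M⁻¹⌋₊ := Nat.le_floor (by simpa using (one_le_inv₀ hM0).2 hM1)
  have hkM : (⌊M⁻¹⌋₊ : ℝ) * M ≤ 1 := by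
    have := Nat.floor_le (inv_pos.2 hM0).le
    calc (⌊M⁻¹⌋₊ : ℝ) * M ≤ M⁻¹ * M := by gcongr
      _ = 1 := inv_mul_cancel₀ hM0.ne'
  have hk0 : (1 : ℝ) ≤ ⌊M⁻¹⌋₊ := by exact_mod_cast hk1
  refine ⟨⌊M⁻¹⌋₊, hk1, ?_, ?_, ?_⟩
  · have : (⌊M⁻¹⌋₊ : ℝ) * ν⁻¹ ≤ 1 := le_trans (by gcongr; exact le_max_left _ _) hkM
    rwa [← div_eq_mul_inv, div_le_one hν0] at this
  · have : (⌊M⁻¹⌋₊ : ℝ) * (4 * ε) ≤ 1 := le_trans (by gcongr; exact le_max_right _ _) hkM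
    linarith
  · have h := Nat.lt_floor_add_one M⁻¹
    rw [div_le_iff₀ (by linarith)]
    have h2 : M * M⁻¹ ≤ M * (2 * ⌊M⁻¹⌋₊) := by gcongr; linarith
    rw [mul_inv_cancel₀ hM0.ne'] at h2
    linarith

end ArcEstimate

/-- Estimate on the L²(σ)-norm of the orthonormal polynomial `φ_m` localized to an arc `I` of
angular length `1/ν`: for each `ℓ ≥ 2`,
`∫_I |φ_m|² dσ ≤ C_ℓ (ν⁻¹ + ∑_{n≥0}(n+1)^{−ℓ} ∑_{|s−m|<ν(n+1)} |γ_s|² + (m/ν)^{−ℓ})`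
whenever `m ≥ ν ≥ 1`. -/
theorem opuc_arc_estimate
    (σ : Measure ℂ) [IsProbabilityMeasure σ] (hcirc : OnCircle σ) (hinf : InfiniteSupport σ)
    (γ : ℕ → ℂ) (hV : IsVerblunsky γ σ)
    (hsum : Summable fun n => ‖γ n‖ ^ 2) (hsum4 : (∑' n, ‖γ n‖ ^ 2) ≤ 1 / 4)
    (ℓ : ℕ) (hℓ : 2 ≤ ℓ) :
    ∃ C : ℝ, 0 < C ∧ ∀ ν : ℝ, 1 ≤ ν → ∀ x₀ : ℝ, ∀ m : ℕ, ν ≤ (m : ℝ) →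
      (∫ z in (fun x : ℝ => Complex.exp (x * Complex.I)) ''
          Set.Icc (x₀ - 1 / (2 * ν)) (x₀ + 1 / (2 * ν)), ‖phiN γ σ m z‖ ^ 2 ∂σ) ≤
        C * (ν⁻¹ +
          (∑' n : ℕ, (((n : ℝ) + 1) ^ ℓ)⁻¹ *
            ∑' s : ℕ, (if |(s : ℝ) - (m : ℝ)| < ν * ((n : ℝ) + 1) then ‖γ s‖ ^ 2 else 0)) +
          (((m : ℝ) / ν) ^ ℓ)⁻¹) := by
  refine ⟨512, by norm_num, fun ν hν x₀ m hm => ?_⟩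
  set w : ℕ → ℕ → ℝ := fun n s =>
    if |(s : ℝ) - (m : ℝ)| < ν * ((n : ℝ) + 1) then ‖γ s‖ ^ 2 else 0 with hw
  have hw0 (n s : ℕ) : 0 ≤ w n s := by
    simp only [hw]; split_ifs <;> positivity
  have hwle (n s : ℕ) : w n s ≤ ‖γ s‖ ^ 2 := by
    simp only [hw]; split_ifs
    · exact le_rfl
    · positivity
  have hwsum (n : ℕ) : Summable (w n) := hsum.of_nonneg_of_le (hw0 n) (hwle n)
  have hw4 (n : ℕ) : ∑' s, w n s ≤ 1 / 4 := ((hwsum n).tsum_le_tsum (hwle n) hsum).trans hsum4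
  have hwnn (n : ℕ) : 0 ≤ ∑' s, w n s := tsum_nonneg (hw0 n)
  have hν0 : 0 < ν := one_pos.trans_le hν
  obtain ⟨k, hk, hkν, hkε, hkM⟩ := exists_nat_scale hν (hw4 0)
  have hkγ : ∑ j ∈ Finset.range k, ‖γ (m + j)‖ ≤ 1 / 2 := by
    have hle : ∑ j ∈ Finset.range k, ‖γ (m + j)‖ ^ 2 ≤ ∑' s, w 0 s := by
      have h := (hwsum 0).sum_le_tsum ((Finset.range k).map (addLeftEmbedding m))
        fun s _ => hw0 0 s
      simp only [Finset.sum_map, addLeftEmbedding_apply] at h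
      refine le_trans (le_of_eq (Finset.sum_congr rfl fun j hj => ?_)) h
      have hjk : (j : ℝ) < k := by exact_mod_cast Finset.mem_range.1 hj
      have : |((m + j : ℕ) : ℝ) - (m : ℝ)| < ν * (((0 : ℕ) : ℝ) + 1) := by
        rw [Nat.cast_add, add_sub_cancel_left, abs_of_nonneg (Nat.cast_nonneg j)]
        simpa using hjk.trans_le hkν
      simp only [hw, if_pos this]
    have hcs := sq_sum_le_card_mul_sum_sq (s := Finset.range k) (f := fun j => ‖γ (m + j)‖)
    rw [Finset.card_range] at hcs
    have hk' := mul_le_mul_of_nonneg_left hle (Nat.cast_nonneg (α := ℝ) k)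
    refine abs_le_of_sq_le_sq' ?_ (by norm_num) |>.2
    linarith
  have hmain := setIntegral_arc_norm_phiN_sq_le hcirc hV hsum hsum4 hν x₀ m hk hkν hkγ
  have hT : ∑' s, w 0 s ≤ ∑' n : ℕ, (((n : ℝ) + 1) ^ ℓ)⁻¹ * ∑' s, w n s := by
    have hs : Summable fun n : ℕ => (((n : ℝ) + 1) ^ ℓ)⁻¹ := by
      have := (summable_nat_add_iff 1).2 (Real.summable_nat_pow_inv.2 (by omega : 1 < ℓ))
      simpa using this
    have hs' : Summable fun n : ℕ => (((n : ℝ) + 1) ^ ℓ)⁻¹ * ∑' s, w n s :=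
      (hs.mul_right (1 / 4)).of_nonneg_of_le (fun n => mul_nonneg (by positivity) (hwnn n))
        fun n => mul_le_mul_of_nonneg_left (hw4 n) (by positivity)
    simpa using hs'.le_tsum 0 fun n _ => mul_nonneg (by positivity) (hwnn n)
  have hmax : max ν⁻¹ (4 * ∑' s, w 0 s) ≤ ν⁻¹ + 4 * ∑' s, w 0 s :=
    max_le_add_of_nonneg (by positivity) (mul_nonneg (by norm_num) (hwnn 0))
  have hlast : 0 ≤ (((m : ℝ) / ν) ^ ℓ)⁻¹ := by positivity
  have hνi : 0 < ν⁻¹ := inv_pos.2 hν0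
  calc _ ≤ 64 / (k : ℝ) := hmain
    _ = 64 * (1 / (k : ℝ)) := div_eq_mul_one_div _ _
    _ ≤ 512 * (ν⁻¹ + (∑' n : ℕ, (((n : ℝ) + 1) ^ ℓ)⁻¹ * ∑' s, w n s) +
        (((m : ℝ) / ν) ^ ℓ)⁻¹) := by linarith

end
end

section
/- Let σ be any probability measure on the unit circle 𝕋 and let H ⊆ L²(σ) be the closure of the linear span of the monomials {z ↦ z^n : n ≥ 0}. Then for every integer u ≥ 1, the L²(σ)-distance of the function z ↦ z^{−1} to H is at most the L²(σ)-distance of the function z ↦ z^{−u−1} to H; equivalently, ‖Proj_H(z^{−u−1})‖_{2,σ} ≤ ‖Proj_H(z^{−1})‖_{2,σ}, where Proj_H denotes orthogonal projection onto H. -/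
open MeasureTheory Filter Topology Polynomial

noncomputable section

/-- The L²(σ)-distance of a function `g` to the closure `H` of the span of the monomials
`{z^n : n ≥ 0}`, computed as the infimum of distances to polynomial functions. -/
def distToPolys (σ : Measure ℂ) (g : ℂ → ℂ) : ℝ :=
  sInf (Set.range fun p : Polynomial ℂ => l2norm σ fun z => g z - p.eval z)

/-- On the circle, multiplication by a power of `z` does not change the L²-norm. -/
theorem l2norm_pow_mul {σ : Measure ℂ} (hcirc : OnCircle σ) (n : ℕ) {f g : ℂ → ℂ}
    (h : ∀ z : ℂ, ‖z‖ = 1 → f z = z ^ n * g z) : l2norm σ f = l2norm σ g := by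
  unfold l2norm
  congr 1
  refine integral_congr_ae ?_
  filter_upwards [hcirc] with z hz
  simp [h z hz, hz]

/-- For every `u ≥ 1`, the L²(σ)-distance of `z ↦ z⁻¹` to `H` is at most that of
`z ↦ z^{−u−1}`; equivalently `‖Proj_H(z^{−u−1})‖ ≤ ‖Proj_H(z^{−1})‖`. -/
theorem dist_inv_le_dist_inv_pow
    (σ : Measure ℂ) [IsProbabilityMeasure σ] (hcirc : OnCircle σ)
    (u : ℕ) (hu : 1 ≤ u) :
    distToPolys σ (fun z => z ^ (-1 : ℤ)) ≤
      distToPolys σ (fun z => z ^ (-(u : ℤ) - 1)) := by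
  refine le_csInf (Set.range_nonempty _) ?_
  rintro _ ⟨p, rfl⟩
  refine csInf_le ⟨0, ?_⟩ ⟨X ^ u * p, l2norm_pow_mul hcirc u fun z hz => ?_⟩
  · rintro _ ⟨q, rfl⟩
    exact Real.sqrt_nonneg _
  · have hz0 : z ≠ 0 := norm_ne_zero_iff.mp (by simp [hz])
    have hpow : z ^ (-1 : ℤ) = z ^ u * z ^ (-(u : ℤ) - 1) := by
      rw [← zpow_natCast, ← zpow_add₀ hz0]
      congr 1
      ring
    beta_reduce
    rw [hpow, eval_mul, eval_pow, eval_X]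
    ring

end
end

section
/- Let {γ_n}_{n≥0} be real numbers with γ_n ∈ (−1,1) and ∑_{n≥0} γ_n² < ∞, with the conventions γ_{−1} := −1 and γ_{−2} := 0, and let b_{k+1}, v_{k+1} (k ≥ 0) be defined by the Geronimus relations. Then ∑_{k=0}^∞ | b_{k+1} − 1/2 − (γ_{2k+1} − γ_{2k−1})/4 | < ∞ and ∑_{k=0}^∞ | v_{k+1} − (γ_{2k} − γ_{2k−2})/2 | < ∞. -/
open Filter Topology

noncomputable section

/-- Extension of the Verblunsky sequence with the conventions γ₋₁ = −1 and γ₋₂ = 0. -/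
def gammaExt (γ : ℕ → ℝ) : ℤ → ℝ := fun n =>
  if n = -1 then -1 else if 0 ≤ n then γ n.toNat else 0

/-- The Geronimus relation for the off-diagonal coefficients: `geronimusB γ k` is `b_{k+1}`. -/
def geronimusB (γ : ℕ → ℝ) (k : ℕ) : ℝ :=
  (1 / 2) * Real.sqrt ((1 - gammaExt γ (2 * (k : ℤ) - 1)) * (1 - gammaExt γ (2 * (k : ℤ)) ^ 2) *
    (1 + gammaExt γ (2 * (k : ℤ) + 1)))

/-- The Geronimus relation for the diagonal coefficients: `geronimusV γ k` is `v_{k+1}`. -/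
def geronimusV (γ : ℕ → ℝ) (k : ℕ) : ℝ :=
  -(1 / 2) * (gammaExt γ (2 * (k : ℤ) - 2) * (1 + gammaExt γ (2 * (k : ℤ) - 1)) -
    gammaExt γ (2 * (k : ℤ)) * (1 - gammaExt γ (2 * (k : ℤ) - 1)))

lemma abs_sqrt_sub_one_sub_half_le {P : ℝ} (hP : 0 ≤ P) :
    |√P - 1 - (P - 1) / 2| ≤ (P - 1) ^ 2 / 2 := by
  have hs := Real.sqrt_nonneg P
  have hsq := Real.sq_sqrt hP
  generalize √P = s at hs hsq
  subst hsq
  rw [abs_le]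
  constructor
  · nlinarith [mul_nonneg (sq_nonneg (s - 1)) (by positivity : 0 ≤ s ^ 2 + 2 * s)]
  · nlinarith [sq_nonneg (s - 1), sq_nonneg (s ^ 2 - 1)]

lemma abs_sqrt_mul_sub_linear_le {x y z : ℝ} (hx : |x| ≤ 1) (hy : |y| ≤ 1) (hz : |z| ≤ 1) :
    |√((1 - x) * (1 - y ^ 2) * (1 + z)) - 1 - (z - x) / 2| ≤
      16 * (x ^ 2 + y ^ 2 + z ^ 2) := by
  have hx' := abs_le.1 hx
  have hz' := abs_le.1 hz
  have hy2 : y ^ 2 ≤ 1 := by rwa [sq_le_one_iff_abs_le_one]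
  have hQ0 : 0 ≤ (1 - x) * (1 + z) := mul_nonneg (by linarith) (by linarith)
  have hQ4 : (1 - x) * (1 + z) ≤ 4 := by nlinarith
  have hP : 0 ≤ (1 - x) * (1 - y ^ 2) * (1 + z) := by
    have := mul_nonneg hQ0 (sub_nonneg.2 hy2)
    linarith
  have hsqrt := abs_sqrt_sub_one_sub_half_le hP
  have hPx : (1 - x) * (1 - y ^ 2) * (1 + z) - 1 =
      z - x * (1 + z) - y ^ 2 * ((1 - x) * (1 + z)) := by ring
  have hlin : |((1 - x) * (1 - y ^ 2) * (1 + z) - 1) / 2 - (z - x) / 2| ≤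
      (x ^ 2 + z ^ 2) / 4 + 2 * y ^ 2 := by
    have hyQ := mul_le_mul_of_nonneg_left hQ4 (sq_nonneg y)
    have hyQ' := mul_nonneg (sq_nonneg y) hQ0
    rw [abs_le]
    constructor <;> nlinarith [sq_nonneg (x + z), sq_nonneg (x - z)]
  have hquad : ((1 - x) * (1 - y ^ 2) * (1 + z) - 1) ^ 2 ≤
      21 * (x ^ 2 + y ^ 2 + z ^ 2) := by
    have habs : |(1 - x) * (1 - y ^ 2) * (1 + z) - 1| ≤ |z| + 2 * |x| + 4 * |y| := by
      have h₁ : |x * (1 + z)| ≤ 2 * |x| := by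
        rw [abs_mul, abs_of_nonneg (by linarith : 0 ≤ 1 + z)]
        nlinarith [abs_nonneg x]
      have h₂ : |y ^ 2 * ((1 - x) * (1 + z))| ≤ 4 * |y| := by
        rw [abs_mul, abs_of_nonneg hQ0, abs_pow]
        nlinarith [abs_nonneg y, mul_le_mul_of_nonneg_left hQ4 (sq_nonneg |y|)]
      rw [hPx]
      linarith [abs_sub (z - x * (1 + z)) (y ^ 2 * ((1 - x) * (1 + z))), abs_sub z (x * (1 + z))]
    calc ((1 - x) * (1 - y ^ 2) * (1 + z) - 1) ^ 2
        ≤ (|z| + 2 * |x| + 4 * |y|) ^ 2 := sq_le_sq' (by linarith [(abs_le.1 habs).1])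
          (abs_le.1 habs).2
      _ ≤ 21 * (|x| ^ 2 + |y| ^ 2 + |z| ^ 2) := by
          nlinarith [sq_nonneg (2 * |z| - |x|), sq_nonneg (4 * |z| - |y|),
            sq_nonneg (4 * |x| - 2 * |y|)]
      _ = 21 * (x ^ 2 + y ^ 2 + z ^ 2) := by simp only [sq_abs]
  calc |√((1 - x) * (1 - y ^ 2) * (1 + z)) - 1 - (z - x) / 2|
      = |(√((1 - x) * (1 - y ^ 2) * (1 + z)) - 1 - ((1 - x) * (1 - y ^ 2) * (1 + z) - 1) / 2) +
          (((1 - x) * (1 - y ^ 2) * (1 + z) - 1) / 2 - (z - x) / 2)| := by congr 1; ring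
    _ ≤ _ := abs_add_le _ _
    _ ≤ 16 * (x ^ 2 + y ^ 2 + z ^ 2) := by
        linarith [sq_nonneg x, sq_nonneg y, sq_nonneg z]

lemma abs_gammaExt_le_one {γ : ℕ → ℝ} (hγ : ∀ n, |γ n| ≤ 1) (n : ℤ) : |gammaExt γ n| ≤ 1 := by
  unfold gammaExt
  split_ifs
  · simp
  · exact hγ _
  · simp

lemma summable_sq_gammaExt_two_mul_add {γ : ℕ → ℝ} (hsum : Summable fun n => γ n ^ 2) (m : ℤ)
    (hm : -2 ≤ m) : Summable fun k : ℕ => gammaExt γ (2 * (k : ℤ) + m) ^ 2 := by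
  have hshift : Summable fun n : ℕ => gammaExt γ ((n : ℤ) - 2) ^ 2 := by
    rw [← summable_nat_add_iff 2]
    refine hsum.congr fun n => ?_
    have hn : (n : ℤ) ≠ -1 := by omega
    simp [gammaExt, hn]
  have hinj : Function.Injective fun k : ℕ => 2 * k + (m + 2).toNat := fun a b hab => by
    simp only at hab
    omega
  refine (hshift.comp_injective hinj).congr fun k => ?_
  have h : ((2 * k + (m + 2).toNat : ℕ) : ℤ) - 2 = 2 * (k : ℤ) + m := by omega
  simp only [Function.comp_apply, h]

/-- For a square-summable Verblunsky sequence, the Geronimus coefficients equal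
`1/2 + (γ_{2k+1} − γ_{2k−1})/4` resp. `(γ_{2k} − γ_{2k−2})/2` up to `ℓ¹` errors. -/
theorem geronimus_ell1_expansion
    (γ : ℕ → ℝ) (hγmem : ∀ n, γ n ∈ Set.Ioo (-1 : ℝ) 1)
    (hsum : Summable fun n => γ n ^ 2) :
    Summable (fun k : ℕ =>
      |geronimusB γ k - 1 / 2 -
        (gammaExt γ (2 * (k : ℤ) + 1) - gammaExt γ (2 * (k : ℤ) - 1)) / 4|) ∧
    Summable (fun k : ℕ =>
      |geronimusV γ k - (gammaExt γ (2 * (k : ℤ)) - gammaExt γ (2 * (k : ℤ) - 2)) / 2|) := by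
  have habs := abs_gammaExt_le_one fun n => abs_le.2 ⟨(hγmem n).1.le, (hγmem n).2.le⟩
  have hs₀ : Summable fun k : ℕ => gammaExt γ (2 * (k : ℤ)) ^ 2 := by
    simpa using summable_sq_gammaExt_two_mul_add hsum 0 (by norm_num)
  have hs₁ := summable_sq_gammaExt_two_mul_add hsum 1 (by norm_num)
  have hsn₁ : Summable fun k : ℕ => gammaExt γ (2 * (k : ℤ) - 1) ^ 2 := by
    simpa only [sub_eq_add_neg] using summable_sq_gammaExt_two_mul_add hsum (-1) (by norm_num)
  have hsn₂ : Summable fun k : ℕ => gammaExt γ (2 * (k : ℤ) - 2) ^ 2 := by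
    simpa only [sub_eq_add_neg] using summable_sq_gammaExt_two_mul_add hsum (-2) (by norm_num)
  constructor
  · refine (((hsn₁.add hs₀).add hs₁).mul_left 8).of_nonneg_of_le (fun _ => abs_nonneg _)
      fun k => ?_
    have h := abs_le.1 (abs_sqrt_mul_sub_linear_le (habs (2 * (k : ℤ) - 1)) (habs (2 * (k : ℤ)))
      (habs (2 * (k : ℤ) + 1)))
    unfold geronimusB
    rw [abs_le]
    constructor <;> linarith [h.1, h.2]
  · refine ((hsn₁.add hs₀).add hsn₂).of_nonneg_of_le (fun _ => abs_nonneg _) fun k => ?_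
    unfold geronimusV
    generalize gammaExt γ (2 * (k : ℤ) - 1) = x
    generalize gammaExt γ (2 * (k : ℤ)) = y
    generalize gammaExt γ (2 * (k : ℤ) - 2) = w
    rw [abs_le]
    constructor <;>
      linarith [sq_nonneg (x + y), sq_nonneg (x - y), sq_nonneg (x + w), sq_nonneg (x - w),
        sq_nonneg y, sq_nonneg w]
end
end
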